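/- arXiv:1004.5061 — 4 statements merged into one kernel-verified Lean document; each statement's English description precedes it below -/
import Mathlib

section
/- Let X be a real Banach space and r ∈ [2, ∞). Assume X satisfies condition (C_r) with constants k₁, k₂ > 0. Let (Ω, 𝒜, P) be a probability space and let Y = L^r(Ω; X) be the Bochner space of strongly measurable X-valued functions with r-integrable norm. Then Y satisfies condition (C_r) with the same constants k₁, k₂; that is, the function ψ : Y → ℝ, ψ(y) = ‖y‖_{L^r(Ω;X)}^r, is twice continuously Fréchet differentiable and ‖ψ'(y)‖ ≤ k₁ ‖y‖^{r−1} and ‖ψ''(y)‖ ≤ k₂ ‖y‖^{r−2} for all y ∈ Y. -/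
open MeasureTheory

/-- A real Banach space `X` satisfies condition `(C_r)` with constants `k₁, k₂ > 0` if the
function `φ : X → ℝ`, `φ x = ‖x‖^r`, is twice continuously Fréchet differentiable and
`‖φ'(x)‖ ≤ k₁ ‖x‖^(r-1)` and `‖φ''(x)‖ ≤ k₂ ‖x‖^(r-2)` for all `x ∈ X`. -/
def ConditionCr (X : Type*) [NormedAddCommGroup X] [NormedSpace ℝ X]
    (r k₁ k₂ : ℝ) : Prop :=
  ContDiff ℝ 2 (fun x : X => ‖x‖ ^ r) ∧
  (∀ x : X, ‖fderiv ℝ (fun x : X => ‖x‖ ^ r) x‖ ≤ k₁ * ‖x‖ ^ (r - 1)) ∧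
  (∀ x : X, ‖fderiv ℝ (fderiv ℝ (fun x : X => ‖x‖ ^ r)) x‖ ≤ k₂ * ‖x‖ ^ (r - 2))

open Filter Topology

section Holder

variable {Ω : Type*} [MeasurableSpace Ω] {μ : Measure Ω}

/-- Hölder's inequality for three nonnegative integrable real functions and weights `a + b + c = 1`,
together with integrability of the weighted product. -/
theorem integrable_rpow_mul_rpow_mul_rpow {f g h : Ω → ℝ} (hf : Integrable f μ)
    (hg : Integrable g μ) (hh : Integrable h μ) (hf0 : ∀ ω, 0 ≤ f ω) (hg0 : ∀ ω, 0 ≤ g ω)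
    (hh0 : ∀ ω, 0 ≤ h ω) {a b c : ℝ} (ha : 0 ≤ a) (hb : 0 ≤ b) (hc : 0 ≤ c)
    (habc : a + b + c = 1) :
    Integrable (fun ω => f ω ^ a * g ω ^ b * h ω ^ c) μ ∧
      ∫ ω, f ω ^ a * g ω ^ b * h ω ^ c ∂μ ≤
        (∫ ω, f ω ∂μ) ^ a * (∫ ω, g ω ∂μ) ^ b * (∫ ω, h ω ∂μ) ^ c := by
  have hnn : ∀ ω, 0 ≤ f ω ^ a * g ω ^ b * h ω ^ c := fun ω =>
    mul_nonneg (mul_nonneg (Real.rpow_nonneg (hf0 ω) _) (Real.rpow_nonneg (hg0 ω) _))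
      (Real.rpow_nonneg (hh0 ω) _)
  have hIf : 0 ≤ ∫ ω, f ω ∂μ := integral_nonneg hf0
  have hIg : 0 ≤ ∫ ω, g ω ∂μ := integral_nonneg hg0
  have hIh : 0 ≤ ∫ ω, h ω ∂μ := integral_nonneg hh0
  have hbnn : 0 ≤ (∫ ω, f ω ∂μ) ^ a * (∫ ω, g ω ∂μ) ^ b * (∫ ω, h ω ∂μ) ^ c := by positivity
  have hmeas : AEStronglyMeasurable (fun ω => f ω ^ a * g ω ^ b * h ω ^ c) μ :=
    ((((hf.aemeasurable.pow_const a).mul (hg.aemeasurable.pow_const b)).mul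
      (hh.aemeasurable.pow_const c))).aestronglyMeasurable
  have key : ∫⁻ ω, ENNReal.ofReal (f ω ^ a * g ω ^ b * h ω ^ c) ∂μ ≤
      ENNReal.ofReal ((∫ ω, f ω ∂μ) ^ a * (∫ ω, g ω ∂μ) ^ b * (∫ ω, h ω ∂μ) ^ c) := by
    have H := ENNReal.lintegral_prod_norm_pow_le (μ := μ) (Finset.univ : Finset (Fin 3))
      (f := fun i ω => ENNReal.ofReal (![f, g, h] i ω)) (p := ![a, b, c])
      (by
        intro i _
        fin_cases i
        · exact hf.aemeasurable.ennreal_ofReal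
        · exact hg.aemeasurable.ennreal_ofReal
        · exact hh.aemeasurable.ennreal_ofReal)
      (by simpa [Fin.sum_univ_three] using habc)
      (by intro i _; fin_cases i <;> simpa)
    simp only [Fin.prod_univ_three, Matrix.cons_val_zero, Matrix.cons_val_one,
      Matrix.cons_val] at H
    rw [ENNReal.ofReal_mul (by positivity), ENNReal.ofReal_mul (by positivity),
      ← ENNReal.ofReal_rpow_of_nonneg hIf ha, ← ENNReal.ofReal_rpow_of_nonneg hIg hb,
      ← ENNReal.ofReal_rpow_of_nonneg hIh hc,
      ofReal_integral_eq_lintegral_ofReal hf (ae_of_all _ hf0),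
      ofReal_integral_eq_lintegral_ofReal hg (ae_of_all _ hg0),
      ofReal_integral_eq_lintegral_ofReal hh (ae_of_all _ hh0)]
    refine le_trans (le_of_eq (lintegral_congr fun ω => ?_)) H
    rw [ENNReal.ofReal_mul
        (mul_nonneg (Real.rpow_nonneg (hf0 ω) _) (Real.rpow_nonneg (hg0 ω) _)),
      ENNReal.ofReal_mul (Real.rpow_nonneg (hf0 ω) _),
      ENNReal.ofReal_rpow_of_nonneg (hf0 ω) ha, ENNReal.ofReal_rpow_of_nonneg (hg0 ω) hb,
      ENNReal.ofReal_rpow_of_nonneg (hh0 ω) hc]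
  refine ⟨⟨hmeas, ?_⟩, ?_⟩
  · rw [hasFiniteIntegral_iff_ofReal (ae_of_all _ hnn)]
    exact key.trans_lt ENNReal.ofReal_lt_top
  · rw [integral_eq_lintegral_of_nonneg_ae (ae_of_all _ hnn) hmeas]
    exact ENNReal.toReal_le_of_le_ofReal hbnn key

variable {X : Type*} [NormedAddCommGroup X] {r : ℝ}

theorem integrable_norm_rpow_Lp (hr : 0 < r) (y : Lp X (ENNReal.ofReal r) μ) :
    Integrable (fun ω => ‖y ω‖ ^ r) μ := by
  have := (Lp.memLp y).integrable_norm_rpow (by simpa using hr) ENNReal.ofReal_ne_top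
  rwa [ENNReal.toReal_ofReal hr.le] at this

theorem norm_Lp_eq_integral_rpow (hr : 0 < r) (y : Lp X (ENNReal.ofReal r) μ) :
    ‖y‖ = (∫ ω, ‖y ω‖ ^ r ∂μ) ^ (1 / r) := by
  have h0 : 0 ≤ ∫ ω, ‖y ω‖ ^ r ∂μ := integral_nonneg fun ω => by positivity
  rw [Lp.norm_def, (Lp.memLp y).eLpNorm_eq_integral_rpow_norm (by simpa using hr)
    ENNReal.ofReal_ne_top, ENNReal.toReal_ofReal hr.le,
    ENNReal.toReal_ofReal (Real.rpow_nonneg h0 _), one_div]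

theorem norm_Lp_rpow (hr : 0 < r) (y : Lp X (ENNReal.ofReal r) μ) :
    ‖y‖ ^ r = ∫ ω, ‖y ω‖ ^ r ∂μ := by
  have h0 : 0 ≤ ∫ ω, ‖y ω‖ ^ r ∂μ := integral_nonneg fun ω => by positivity
  rw [norm_Lp_eq_integral_rpow hr, ← Real.rpow_mul h0, one_div_mul_cancel hr.ne', Real.rpow_one]

theorem integral_rpow_mul_norm_mul_norm_le (hr : 2 ≤ r) {g : Ω → ℝ} (hg : Integrable g μ)
    (hg0 : ∀ ω, 0 ≤ g ω) (h k : Lp X (ENNReal.ofReal r) μ) :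
    Integrable (fun ω => g ω ^ ((r - 2) / r) * ‖h ω‖ * ‖k ω‖) μ ∧
      ∫ ω, g ω ^ ((r - 2) / r) * ‖h ω‖ * ‖k ω‖ ∂μ ≤
        (∫ ω, g ω ∂μ) ^ ((r - 2) / r) * ‖h‖ * ‖k‖ := by
  have hr0 : 0 < r := by linarith
  have H := integrable_rpow_mul_rpow_mul_rpow (a := (r - 2) / r) (b := 1 / r) (c := 1 / r) hg
    (integrable_norm_rpow_Lp hr0 h)
    (integrable_norm_rpow_Lp hr0 k) hg0 (fun ω => by positivity) (fun ω => by positivity)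
    (div_nonneg (by linarith) hr0.le) (by positivity) (by positivity) (by field_simp; ring)
  rw [← norm_Lp_eq_integral_rpow hr0, ← norm_Lp_eq_integral_rpow hr0] at H
  have e : ∀ x : X, (‖x‖ ^ r) ^ (1 / r) = ‖x‖ := fun x => by
    rw [← Real.rpow_mul (norm_nonneg _), mul_one_div_cancel hr0.ne', Real.rpow_one]
  simpa only [e] using H

end Holder

section LineDeriv

variable {E : Type*} [NormedAddCommGroup E] [NormedSpace ℝ E]

/-- Mean value estimate for a function with given directional derivatives. -/
theorem norm_sub_sub_le_of_hasLineDerivAt {f : E → ℝ} {f' : E → E →L[ℝ] ℝ}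
    (hf : ∀ x h, HasLineDerivAt ℝ f (f' x h) x h) {x z : E} {c δ : ℝ}
    (hz : ‖z - x‖ < δ) (hc : ∀ w, ‖w - x‖ < δ → ‖f' w (z - x) - f' x (z - x)‖ ≤ c) :
    ‖f z - f x - f' x (z - x)‖ ≤ c := by
  have hd : ∀ t : ℝ, HasDerivAt (fun t : ℝ => f (x + t • (z - x)) - t * f' x (z - x))
      (f' (x + t • (z - x)) (z - x) - f' x (z - x)) t := by
    intro t
    have h1 : HasDerivAt (fun s : ℝ => f (x + t • (z - x) + s • (z - x)))
      (f' (x + t • (z - x)) (z - x)) (t - t) := by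
      rw [sub_self]; exact hf _ _
    have h2 := h1.comp_sub_const t t
    have h3 : HasDerivAt (fun s : ℝ => s * f' x (z - x)) (f' x (z - x)) t := by
      simpa using (hasDerivAt_id t).mul_const (f' x (z - x))
    refine HasDerivAt.sub ?_ h3
    convert h2 using 3 with s
    rw [add_assoc, ← add_smul]; congr 3; ring
  have := norm_image_sub_le_of_norm_deriv_le_segment_01'
    (fun t _ => (hd t).hasDerivWithinAt) (C := c) (fun t ht => hc _ (by
      have : ‖t • (z - x)‖ ≤ ‖z - x‖ := by
        rw [norm_smul, Real.norm_of_nonneg ht.1]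
        exact mul_le_of_le_one_left (norm_nonneg _) ht.2.le
      simpa using this.trans_lt hz))
  have e : f z - f x - f' x (z - x) = f (x + (1 : ℝ) • (z - x)) - 1 * f' x (z - x) -
      (f (x + (0 : ℝ) • (z - x)) - 0 * f' x (z - x)) := by
    simp only [one_smul, zero_smul, add_sub_cancel, add_zero]; ring
  rwa [e]

omit [NormedSpace ℝ E] in
theorem exists_norm_sub_le_of_continuous {F : Type*} [NormedAddCommGroup F] {f : E → F}
    (hf : Continuous f) (x : E) {c : ℝ} (hc : 0 < c) :
    ∃ δ > 0, ∀ w, ‖w - x‖ < δ → ‖f w - f x‖ ≤ c := by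
  obtain ⟨δ, hδ, H⟩ := Metric.continuousAt_iff.1 hf.continuousAt c hc
  refine ⟨δ, hδ, fun w hw => ?_⟩
  rw [← dist_eq_norm] at hw ⊢
  exact (H hw).le

theorem hasFDerivAt_of_hasLineDerivAt {f : E → ℝ} {f' : E → E →L[ℝ] ℝ}
    (hf : ∀ x h, HasLineDerivAt ℝ f (f' x h) x h) (hc : Continuous f') (x : E) :
    HasFDerivAt f (f' x) x := by
  rw [hasFDerivAt_iff_isLittleO, Asymptotics.isLittleO_iff]
  intro c hc0
  obtain ⟨δ, hδ, H⟩ := exists_norm_sub_le_of_continuous hc x hc0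
  filter_upwards [Metric.ball_mem_nhds x hδ] with z hz
  refine norm_sub_sub_le_of_hasLineDerivAt hf (by rwa [← dist_eq_norm]) fun w hw => ?_
  rw [← sub_apply]
  refine ContinuousLinearMap.le_of_opNorm_le _ ?_ _
  exact H w hw

theorem hasFDerivAt_of_hasLineDerivAt_apply {f : E → E →L[ℝ] ℝ} {f' : E → E →L[ℝ] E →L[ℝ] ℝ}
    (hf : ∀ x h k, HasLineDerivAt ℝ (fun y => f y k) (f' x h k) x h) (hc : Continuous f')
    (x : E) : HasFDerivAt f (f' x) x := by
  rw [hasFDerivAt_iff_isLittleO, Asymptotics.isLittleO_iff]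
  intro c hc0
  obtain ⟨δ, hδ, H⟩ := exists_norm_sub_le_of_continuous (F := E →L[ℝ] E →L[ℝ] ℝ) hc x hc0
  filter_upwards [Metric.ball_mem_nhds x hδ] with z hz
  refine ContinuousLinearMap.opNorm_le_bound _ (by positivity) fun k => ?_
  refine norm_sub_sub_le_of_hasLineDerivAt (f := fun y => f y k) (f' := fun y => (f' y).flip k)
    (fun x h => hf x h k) (by rwa [← dist_eq_norm]) fun w hw => ?_
  rw [ContinuousLinearMap.flip_apply, ContinuousLinearMap.flip_apply, ← sub_apply,
    ← sub_apply]
  refine ContinuousLinearMap.le_of_opNorm_le _ (ContinuousLinearMap.le_of_opNorm_le _ ?_ _) _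
  exact H w hw

end LineDeriv

section Integrals

variable {Ω : Type*} [MeasurableSpace Ω] {μ : Measure Ω} {X : Type*} [NormedAddCommGroup X]
  [NormedSpace ℝ X] {r : ℝ}

theorem rpow_rpow_sub_two_div {x : ℝ} (hx : 0 ≤ x) (hr : 2 ≤ r) :
    (x ^ r) ^ ((r - 2) / r) = x ^ (r - 2) := by
  rw [← Real.rpow_mul hx, mul_div_cancel₀ _ (by linarith)]

theorem rpow_sub_two_mul {x : ℝ} (hx : 0 ≤ x) (hr : 2 ≤ r) : x ^ (r - 2) * x = x ^ (r - 1) := by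
  rw [← Real.rpow_add_one' hx (by linarith)]; congr 1; ring

omit [NormedSpace ℝ X] in
theorem norm_Lp_nonneg {p : ENNReal} (y : Lp X p μ) : 0 ≤ ‖y‖ := by
  rw [Lp.norm_def]
  exact ENNReal.toReal_nonneg

omit [NormedSpace ℝ X] in
theorem integral_norm_rpow_rpow (hr : 2 ≤ r) (y : Lp X (ENNReal.ofReal r) μ) :
    (∫ ω, ‖y ω‖ ^ r ∂μ) ^ ((r - 2) / r) = ‖y‖ ^ (r - 2) := by
  rw [← norm_Lp_rpow (by linarith), rpow_rpow_sub_two_div (norm_Lp_nonneg y) hr]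

theorem aestronglyMeasurable_clm_apply {E F : Type*} [NormedAddCommGroup E] [NormedSpace ℝ E]
    [NormedAddCommGroup F] [NormedSpace ℝ F] {G : Ω → E →L[ℝ] F} {f : Ω → E}
    (hG : AEStronglyMeasurable G μ) (hf : AEStronglyMeasurable f μ) :
    AEStronglyMeasurable (fun ω => G ω (f ω)) μ :=
  (ContinuousLinearMap.id ℝ (E →L[ℝ] F)).aestronglyMeasurable_comp₂ hG hf

section Bilinear

variable {G : Ω → X →L[ℝ] X →L[ℝ] ℝ} {c : ℝ} {g : Ω → ℝ}

theorem integrable_clm_apply_apply (hr : 2 ≤ r) (hG : AEStronglyMeasurable G μ)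
    (hg : Integrable g μ) (hg0 : ∀ ω, 0 ≤ g ω) (hGg : ∀ ω, ‖G ω‖ ≤ c * g ω ^ ((r - 2) / r))
    (h k : Lp X (ENNReal.ofReal r) μ) : Integrable (fun ω => G ω (h ω) (k ω)) μ := by
  refine ((integral_rpow_mul_norm_mul_norm_le hr hg hg0 h k).1.const_mul c).mono'
    (aestronglyMeasurable_clm_apply (aestronglyMeasurable_clm_apply hG (Lp.aestronglyMeasurable h))
      (Lp.aestronglyMeasurable k)) (ae_of_all _ fun ω => ?_)
  refine ((G ω).le_opNorm₂ _ _).trans ?_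
  rw [← mul_assoc, ← mul_assoc]
  gcongr
  exact hGg ω

theorem norm_integral_clm_apply_apply_le (hr : 2 ≤ r) (hc : 0 ≤ c)
    (hg : Integrable g μ) (hg0 : ∀ ω, 0 ≤ g ω) (hGg : ∀ ω, ‖G ω‖ ≤ c * g ω ^ ((r - 2) / r))
    (h k : Lp X (ENNReal.ofReal r) μ) :
    ‖∫ ω, G ω (h ω) (k ω) ∂μ‖ ≤ c * (∫ ω, g ω ∂μ) ^ ((r - 2) / r) * ‖h‖ * ‖k‖ := by
  obtain ⟨h1, h2⟩ := integral_rpow_mul_norm_mul_norm_le hr hg hg0 h k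
  calc ‖∫ ω, G ω (h ω) (k ω) ∂μ‖
      ≤ ∫ ω, c * (g ω ^ ((r - 2) / r) * ‖h ω‖ * ‖k ω‖) ∂μ := by
        refine norm_integral_le_of_norm_le (h1.const_mul c) (ae_of_all _ fun ω => ?_)
        refine ((G ω).le_opNorm₂ _ _).trans ?_
        rw [← mul_assoc, ← mul_assoc]
        gcongr
        exact hGg ω
    _ ≤ c * ((∫ ω, g ω ∂μ) ^ ((r - 2) / r) * ‖h‖ * ‖k‖) := by
        rw [integral_const_mul]; gcongr
    _ = _ := by ring

theorem exists_clm_eq_integral_apply_apply [Fact (1 ≤ ENNReal.ofReal r)] (hr : 2 ≤ r) (hc : 0 ≤ c)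
    (hG : AEStronglyMeasurable G μ)
    (hg : Integrable g μ) (hg0 : ∀ ω, 0 ≤ g ω) (hGg : ∀ ω, ‖G ω‖ ≤ c * g ω ^ ((r - 2) / r)) :
    ∃ B : Lp X (ENNReal.ofReal r) μ →L[ℝ] Lp X (ENNReal.ofReal r) μ →L[ℝ] ℝ,
      ∀ h k, B h k = ∫ ω, G ω (h ω) (k ω) ∂μ := by
  have hi := integrable_clm_apply_apply hr hG hg hg0 hGg
  refine ⟨LinearMap.mkContinuous₂ (LinearMap.mk₂ ℝ (fun h k => ∫ ω, G ω (h ω) (k ω) ∂μ)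
    ?_ ?_ ?_ ?_) (c * (∫ ω, g ω ∂μ) ^ ((r - 2) / r))
    fun h k => norm_integral_clm_apply_apply_le hr hc hg hg0 hGg h k, fun h k => rfl⟩
  · intro h h' k
    rw [← integral_add (hi h k) (hi h' k)]
    refine integral_congr_ae ?_
    filter_upwards [Lp.coeFn_add h h'] with ω hω
    simp only [hω, Pi.add_apply, map_add, add_apply]
  · intro a h k
    rw [← integral_smul]
    refine integral_congr_ae ?_
    filter_upwards [Lp.coeFn_smul a h] with ω hω
    simp only [hω, Pi.smul_apply, map_smul, smul_apply]
  · intro h k k'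
    rw [← integral_add (hi h k) (hi h k')]
    refine integral_congr_ae ?_
    filter_upwards [Lp.coeFn_add k k'] with ω hω
    simp only [hω, Pi.add_apply, map_add]
  · intro a h k
    rw [← integral_smul]
    refine integral_congr_ae ?_
    filter_upwards [Lp.coeFn_smul a k] with ω hω
    simp only [hω, Pi.smul_apply, map_smul]

end Bilinear

section Linear

variable {G : Ω → X →L[ℝ] ℝ} {c : ℝ}

omit [NormedSpace ℝ X] in
theorem integral_norm_rpow_mul_norm_le (hr : 2 ≤ r) (y h : Lp X (ENNReal.ofReal r) μ) :
    Integrable (fun ω => ‖y ω‖ ^ (r - 1) * ‖h ω‖) μ ∧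
      ∫ ω, ‖y ω‖ ^ (r - 1) * ‖h ω‖ ∂μ ≤ ‖y‖ ^ (r - 1) * ‖h‖ := by
  have := integral_rpow_mul_norm_mul_norm_le hr
    (integrable_norm_rpow_Lp (by linarith) y) (fun ω => by positivity) y h
  rw [integral_norm_rpow_rpow hr] at this
  simpa only [rpow_rpow_sub_two_div (norm_nonneg _) hr, rpow_sub_two_mul (norm_nonneg _) hr,
    rpow_sub_two_mul (norm_Lp_nonneg y) hr] using this

theorem integrable_clm_apply (hr : 2 ≤ r) (hG : AEStronglyMeasurable G μ)
    {y : Lp X (ENNReal.ofReal r) μ} (hGy : ∀ ω, ‖G ω‖ ≤ c * ‖y ω‖ ^ (r - 1))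
    (h : Lp X (ENNReal.ofReal r) μ) : Integrable (fun ω => G ω (h ω)) μ := by
  refine ((integral_norm_rpow_mul_norm_le hr y h).1.const_mul c).mono'
    (aestronglyMeasurable_clm_apply hG (Lp.aestronglyMeasurable h)) (ae_of_all _ fun ω => ?_)
  rw [← mul_assoc]
  exact (G ω).le_of_opNorm_le (hGy ω) _

theorem norm_integral_clm_apply_le (hr : 2 ≤ r) (hc : 0 ≤ c)
    {y : Lp X (ENNReal.ofReal r) μ} (hGy : ∀ ω, ‖G ω‖ ≤ c * ‖y ω‖ ^ (r - 1))
    (h : Lp X (ENNReal.ofReal r) μ) :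
    ‖∫ ω, G ω (h ω) ∂μ‖ ≤ c * ‖y‖ ^ (r - 1) * ‖h‖ := by
  obtain ⟨h1, h2⟩ := integral_norm_rpow_mul_norm_le hr y h
  calc ‖∫ ω, G ω (h ω) ∂μ‖
      ≤ ∫ ω, c * (‖y ω‖ ^ (r - 1) * ‖h ω‖) ∂μ := by
        refine norm_integral_le_of_norm_le (h1.const_mul c) (ae_of_all _ fun ω => ?_)
        rw [← mul_assoc]
        exact (G ω).le_of_opNorm_le (hGy ω) _
    _ ≤ c * (‖y‖ ^ (r - 1) * ‖h‖) := by
        rw [integral_const_mul]; gcongr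
    _ = _ := by ring

theorem exists_clm_eq_integral_apply [Fact (1 ≤ ENNReal.ofReal r)] (hr : 2 ≤ r) (hc : 0 ≤ c)
    (hG : AEStronglyMeasurable G μ) {y : Lp X (ENNReal.ofReal r) μ}
    (hGy : ∀ ω, ‖G ω‖ ≤ c * ‖y ω‖ ^ (r - 1)) :
    ∃ A : Lp X (ENNReal.ofReal r) μ →L[ℝ] ℝ, ∀ h, A h = ∫ ω, G ω (h ω) ∂μ := by
  have hi := integrable_clm_apply hr hG hGy
  refine ⟨LinearMap.mkContinuous ⟨⟨fun h => ∫ ω, G ω (h ω) ∂μ, ?_⟩, ?_⟩ (c * ‖y‖ ^ (r - 1))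
    fun h => norm_integral_clm_apply_le hr hc hGy h, fun h => rfl⟩
  · intro h h'
    rw [← integral_add (hi h) (hi h')]
    refine integral_congr_ae ?_
    filter_upwards [Lp.coeFn_add h h'] with ω hω
    simp only [hω, Pi.add_apply, map_add]
  · intro a h
    simp only [RingHom.id_apply]
    rw [← integral_smul]
    refine integral_congr_ae ?_
    filter_upwards [Lp.coeFn_smul a h] with ω hω
    simp only [hω, Pi.smul_apply, map_smul]

end Linear

omit [NormedSpace ℝ X] in
theorem integrable_norm_add_norm_rpow (hr : 0 < r) (y h : Lp X (ENNReal.ofReal r) μ) :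
    Integrable (fun ω => (‖y ω‖ + ‖h ω‖) ^ r) μ := by
  have := ((Lp.memLp y).norm.add (Lp.memLp h).norm).integrable_norm_rpow (by simpa using hr)
    ENNReal.ofReal_ne_top
  rw [ENNReal.toReal_ofReal hr.le] at this
  refine this.congr (ae_of_all _ fun ω => ?_)
  simp only [Pi.add_apply]
  rw [Real.norm_of_nonneg (by positivity)]

theorem norm_add_smul_le_of_mem_ball {x h : X} {t : ℝ} (ht : t ∈ Metric.ball (0 : ℝ) 1) :
    ‖x + t • h‖ ≤ ‖x‖ + ‖h‖ := by
  refine (norm_add_le _ _).trans ?_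
  rw [norm_smul]
  gcongr
  exact mul_le_of_le_one_left (norm_nonneg _) (by simpa using (mem_ball_zero_iff.1 ht).le)

theorem coeFn_add_smul (y h : Lp X (ENNReal.ofReal r) μ) (t : ℝ) :
    ⇑(y + t • h) =ᵐ[μ] fun ω => y ω + t • h ω := by
  filter_upwards [Lp.coeFn_add y (t • h), Lp.coeFn_smul t h] with ω h1 h2
  rw [h1, Pi.add_apply, h2, Pi.smul_apply]

theorem hasDerivAt_comp_add_smul {F : Type*} [NormedAddCommGroup F] [NormedSpace ℝ F]
    {f : X → F} {f' : X → X →L[ℝ] F} (hf : ∀ x, HasFDerivAt f (f' x) x) (x h : X) (t : ℝ) :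
    HasDerivAt (fun t : ℝ => f (x + t • h)) (f' (x + t • h) h) t := by
  have h1 : HasDerivAt (fun t : ℝ => x + t • h) h t := by
    simpa using ((hasDerivAt_id t).smul_const h).const_add x
  exact (hf _).comp_hasDerivAt t h1

theorem hasLineDerivAt_integral_norm_rpow {φ' : X → X →L[ℝ] ℝ} {k₁ : ℝ} (hr : 2 ≤ r)
    (hk₁ : 0 ≤ k₁)
    (hφ : ∀ x, HasFDerivAt (fun x : X => ‖x‖ ^ r) (φ' x) x) (hφ' : Continuous φ')
    (hb : ∀ x, ‖φ' x‖ ≤ k₁ * ‖x‖ ^ (r - 1)) (y h : Lp X (ENNReal.ofReal r) μ) :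
    HasLineDerivAt ℝ (fun y : Lp X (ENNReal.ofReal r) μ => ∫ ω, ‖y ω‖ ^ r ∂μ)
      (∫ ω, φ' (y ω) (h ω) ∂μ) y h := by
  have hr0 : 0 < r := by linarith
  have hy := Lp.aestronglyMeasurable y
  have hh := Lp.aestronglyMeasurable h
  have hu := fun z => (integral_rpow_mul_norm_mul_norm_le hr
    (integrable_norm_add_norm_rpow hr0 y h) (fun ω => by positivity) z h).1
  have e : ∀ t : ℝ, ∫ ω, ‖(y + t • h) ω‖ ^ r ∂μ = ∫ ω, ‖y ω + t • h ω‖ ^ r ∂μ := fun t =>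
    integral_congr_ae ((coeFn_add_smul y h t).mono fun ω hω => by simp only [hω])
  rw [HasLineDerivAt]
  simp only [e]
  have H := (hasDerivAt_integral_of_dominated_loc_of_deriv_le (μ := μ) (x₀ := (0 : ℝ))
    (F := fun t ω => ‖y ω + t • h ω‖ ^ r) (F' := fun t ω => φ' (y ω + t • h ω) (h ω))
    (bound := fun ω => k₁ * (((‖y ω‖ + ‖h ω‖) ^ r) ^ ((r - 2) / r) * ‖y ω‖ * ‖h ω‖
      + ((‖y ω‖ + ‖h ω‖) ^ r) ^ ((r - 2) / r) * ‖h ω‖ * ‖h ω‖))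
    (Metric.ball_mem_nhds 0 one_pos) ?_ ?_ ?_ ?_ ?_ ?_).2
  · simpa using H
  · exact Eventually.of_forall fun t =>
      ((hy.add (hh.const_smul t)).norm.aemeasurable.pow_const r).aestronglyMeasurable
  · simpa using integrable_norm_rpow_Lp hr0 y
  · exact aestronglyMeasurable_clm_apply (hφ'.comp_aestronglyMeasurable
      (hy.add (hh.const_smul (0 : ℝ)))) hh
  · refine ae_of_all _ fun ω t ht => ((φ' _).le_of_opNorm_le (hb _) _).trans ?_
    rw [rpow_rpow_sub_two_div (by positivity) hr, mul_assoc]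
    calc k₁ * (‖y ω + t • h ω‖ ^ (r - 1) * ‖h ω‖)
        ≤ k₁ * ((‖y ω‖ + ‖h ω‖) ^ (r - 1) * ‖h ω‖) := by
          gcongr
          · linarith
          · exact norm_add_smul_le_of_mem_ball ht
      _ = _ := by rw [← rpow_sub_two_mul (by positivity) hr]; ring
  · exact ((hu y).add (hu h)).const_mul k₁
  · exact ae_of_all _ fun ω t _ => hasDerivAt_comp_add_smul hφ _ _ t

theorem hasLineDerivAt_integral_clm_apply {φ' : X → X →L[ℝ] ℝ} {φ'' : X → X →L[ℝ] X →L[ℝ] ℝ}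
    {k₁ k₂ : ℝ} (hr : 2 ≤ r) (hk₂ : 0 ≤ k₂)
    (hφ : ∀ x, HasFDerivAt φ' (φ'' x) x) (hφ'' : Continuous φ'')
    (hb₁ : ∀ x, ‖φ' x‖ ≤ k₁ * ‖x‖ ^ (r - 1)) (hb₂ : ∀ x, ‖φ'' x‖ ≤ k₂ * ‖x‖ ^ (r - 2))
    (y h k : Lp X (ENNReal.ofReal r) μ) :
    HasLineDerivAt ℝ (fun y : Lp X (ENNReal.ofReal r) μ => ∫ ω, φ' (y ω) (k ω) ∂μ)
      (∫ ω, φ'' (y ω) (h ω) (k ω) ∂μ) y h := by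
  have hr0 : 0 < r := by linarith
  have hy := Lp.aestronglyMeasurable y
  have hh := Lp.aestronglyMeasurable h
  have hk := Lp.aestronglyMeasurable k
  have hφ' : Continuous φ' := continuous_iff_continuousAt.2 fun x => (hφ x).continuousAt
  have e : ∀ t : ℝ, ∫ ω, φ' ((y + t • h) ω) (k ω) ∂μ = ∫ ω, φ' (y ω + t • h ω) (k ω) ∂μ :=
    fun t => integral_congr_ae ((coeFn_add_smul y h t).mono fun ω hω => by simp only [hω])
  rw [HasLineDerivAt]
  simp only [e]
  have H := (hasDerivAt_integral_of_dominated_loc_of_deriv_le (μ := μ) (x₀ := (0 : ℝ))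
    (F := fun t ω => φ' (y ω + t • h ω) (k ω))
    (F' := fun t ω => φ'' (y ω + t • h ω) (h ω) (k ω))
    (bound := fun ω => k₂ * (((‖y ω‖ + ‖h ω‖) ^ r) ^ ((r - 2) / r) * ‖h ω‖ * ‖k ω‖))
    (Metric.ball_mem_nhds 0 one_pos) ?_ ?_ ?_ ?_ ?_ ?_).2
  · simpa using H
  · exact Eventually.of_forall fun t => aestronglyMeasurable_clm_apply
      (hφ'.comp_aestronglyMeasurable (hy.add (hh.const_smul t))) hk
  · simpa using integrable_clm_apply hr (hφ'.comp_aestronglyMeasurable hy) (fun ω => hb₁ (y ω)) k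
  · exact aestronglyMeasurable_clm_apply (aestronglyMeasurable_clm_apply
      (hφ''.comp_aestronglyMeasurable (hy.add (hh.const_smul (0 : ℝ)))) hh) hk
  · refine ae_of_all _ fun ω t ht => ((φ'' _).le_of_opNorm₂_le_of_le (hb₂ _) le_rfl le_rfl).trans ?_
    rw [rpow_rpow_sub_two_div (by positivity) hr, mul_assoc, mul_assoc, mul_assoc]
    gcongr
    exact norm_add_smul_le_of_mem_ball ht
  · exact (integral_rpow_mul_norm_mul_norm_le hr
      (integrable_norm_add_norm_rpow hr0 y h) (fun ω => by positivity) h k).1.const_mul k₂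
  · exact ae_of_all _ fun ω t _ => by
      simpa using (hasDerivAt_comp_add_smul hφ (y ω) (h ω) t).clm_apply
        (hasDerivAt_const t (k ω))

end Integrals

section Continuity

variable {Ω : Type*} [MeasurableSpace Ω] {μ : Measure Ω} {X : Type*} [NormedAddCommGroup X]
  {r : ℝ}

theorem norm_sub_rpow_le {F : Type*} [NormedAddCommGroup F] {f : X → F} {c : ℝ} (hr : 2 < r)
    (hc : 0 ≤ c) (hf : ∀ x, ‖f x‖ ≤ c * ‖x‖ ^ (r - 2)) (x y : X) :
    ‖f x - f y‖ ^ (r / (r - 2)) ≤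
      (2 * c) ^ (r / (r - 2)) * 2 ^ r * ‖x - y‖ ^ r + (2 * c) ^ (r / (r - 2)) * 2 ^ r * ‖y‖ ^ r := by
  have hr2 : 0 < r - 2 := by linarith
  set M := max ‖x - y‖ ‖y‖ with hM
  have hM0 : 0 ≤ M := (norm_nonneg y).trans (le_max_right _ _)
  have hx : ‖x‖ ≤ 2 * M := by
    have h1 : ‖x‖ ≤ ‖x - y‖ + ‖y‖ := by simpa using norm_add_le (x - y) y
    linarith [le_max_left ‖x - y‖ ‖y‖, le_max_right ‖x - y‖ ‖y‖]
  have hy : ‖y‖ ≤ 2 * M := by linarith [le_max_right ‖x - y‖ ‖y‖]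
  have h1 : ‖f x - f y‖ ≤ 2 * c * (2 * M) ^ (r - 2) := by
    calc ‖f x - f y‖ ≤ ‖f x‖ + ‖f y‖ := norm_sub_le _ _
      _ ≤ c * ‖x‖ ^ (r - 2) + c * ‖y‖ ^ (r - 2) := add_le_add (hf x) (hf y)
      _ ≤ c * (2 * M) ^ (r - 2) + c * (2 * M) ^ (r - 2) := by gcongr
      _ = _ := by ring
  have hMr : M ^ r ≤ ‖x - y‖ ^ r + ‖y‖ ^ r := by
    rcases max_choice ‖x - y‖ ‖y‖ with h | h
    · rw [hM, h]; linarith [Real.rpow_nonneg (norm_nonneg y) r]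
    · rw [hM, h]; linarith [Real.rpow_nonneg (norm_nonneg (x - y)) r]
  calc ‖f x - f y‖ ^ (r / (r - 2)) ≤ (2 * c * (2 * M) ^ (r - 2)) ^ (r / (r - 2)) := by
        gcongr
    _ = (2 * c) ^ (r / (r - 2)) * 2 ^ r * M ^ r := by
        rw [Real.mul_rpow (by positivity) (by positivity), ← Real.rpow_mul (by positivity),
          mul_div_cancel₀ _ hr2.ne', Real.mul_rpow (by positivity) hM0, mul_assoc]
    _ ≤ (2 * c) ^ (r / (r - 2)) * 2 ^ r * (‖x - y‖ ^ r + ‖y‖ ^ r) := by gcongr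
    _ = _ := by ring

theorem integrable_norm_sub_rpow {F : Type*} [NormedAddCommGroup F] {f : X → F} {c : ℝ}
    (hr : 2 < r) (hc : 0 ≤ c) (hfc : Continuous f) (hf : ∀ x, ‖f x‖ ≤ c * ‖x‖ ^ (r - 2))
    (y z : Lp X (ENNReal.ofReal r) μ) :
    Integrable (fun ω => ‖f (y ω) - f (z ω)‖ ^ (r / (r - 2))) μ := by
  have hr0 : 0 < r := by linarith
  refine (((integrable_norm_rpow_Lp hr0 (y - z)).const_mul
    ((2 * c) ^ (r / (r - 2)) * 2 ^ r)).add ((integrable_norm_rpow_Lp hr0 z).const_mul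
    ((2 * c) ^ (r / (r - 2)) * 2 ^ r))).mono'
    (((hfc.comp_aestronglyMeasurable (Lp.aestronglyMeasurable y)).sub
      (hfc.comp_aestronglyMeasurable
        (Lp.aestronglyMeasurable z))).norm.aemeasurable.pow_const _).aestronglyMeasurable ?_
  filter_upwards [Lp.coeFn_sub y z] with ω hω
  rw [Real.norm_of_nonneg (by positivity), Pi.add_apply, hω, Pi.sub_apply]
  exact norm_sub_rpow_le hr hc hf _ _

/-- Continuity of the superposition operator `y ↦ f ∘ y` from `L^r` to `L^(r/(r-2))`. -/
theorem tendsto_integral_norm_sub_rpow [Fact (1 ≤ ENNReal.ofReal r)]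
    {F : Type*} [NormedAddCommGroup F] {f : X → F} {c : ℝ}
    (hr : 2 < r) (hc : 0 ≤ c) (hfc : Continuous f) (hf : ∀ x, ‖f x‖ ≤ c * ‖x‖ ^ (r - 2))
    (z : Lp X (ENNReal.ofReal r) μ) :
    Tendsto (fun y : Lp X (ENNReal.ofReal r) μ =>
      ∫ ω, ‖f (y ω) - f (z ω)‖ ^ (r / (r - 2)) ∂μ) (𝓝 z) (𝓝 0) := by
  have hr0 : 0 < r := by linarith
  have hq : 0 < r / (r - 2) := div_pos hr0 (by linarith)
  refine tendsto_of_subseq_tendsto fun y hy => ?_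
  obtain ⟨ns, hns, hae⟩ := (tendstoInMeasure_of_tendsto_Lp hy).exists_seq_tendsto_ae
  refine ⟨ns, ?_⟩
  set C := (2 * c) ^ (r / (r - 2)) * 2 ^ r with hC
  have hC0 : 0 ≤ C := by positivity
  set e : ℕ → Ω → ℝ := fun n ω => ‖f (y (ns n) ω) - f (z ω)‖ ^ (r / (r - 2)) with he
  set m : ℕ → Ω → ℝ := fun n ω => C * ‖(y (ns n) - z) ω‖ ^ r with hm
  have hei : ∀ n, Integrable (e n) μ := fun n => integrable_norm_sub_rpow hr hc hfc hf _ _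
  have hmi : ∀ n, Integrable (m n) μ := fun n => (integrable_norm_rpow_Lp hr0 _).const_mul C
  have hpi : ∀ n, Integrable (fun ω => max (e n ω - m n ω) 0) μ :=
    fun n => ((hei n).sub (hmi n)).pos_part
  have h1 : Tendsto (fun n => ∫ ω, max (e n ω - m n ω) 0 ∂μ) atTop (𝓝 0) := by
    have := tendsto_integral_of_dominated_convergence (μ := μ)
      (F := fun n ω => max (e n ω - m n ω) 0) (f := fun _ => (0 : ℝ))
      (fun ω => C * ‖z ω‖ ^ r) (fun n => (hpi n).aestronglyMeasurable)
      ((integrable_norm_rpow_Lp hr0 z).const_mul C) (fun n => ?_) ?_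
    · simpa using this
    · filter_upwards [Lp.coeFn_sub (y (ns n)) z] with ω hω
      rw [Real.norm_of_nonneg (le_max_right _ _)]
      refine max_le ?_ (by positivity)
      have := norm_sub_rpow_le hr hc hf (y (ns n) ω) (z ω)
      simp only [he, hm, hω, Pi.sub_apply]
      linarith
    · filter_upwards [hae] with ω hω
      have h0 : Tendsto (fun n => e n ω) atTop (𝓝 0) := by
        have h2 : Tendsto (fun n => ‖f (y (ns n) ω) - f (z ω)‖) atTop (𝓝 0) :=
          tendsto_iff_norm_sub_tendsto_zero.1 ((hfc.tendsto _).comp hω)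
        have h3 := h2.rpow_const (p := r / (r - 2)) (Or.inr hq.le)
        rwa [Real.zero_rpow hq.ne'] at h3
      refine squeeze_zero (fun n => le_max_right _ _) (fun n => ?_) h0
      have : 0 ≤ m n ω := by simp only [hm]; positivity
      exact max_le (by linarith) (by simp only [he]; positivity)
  have h2 : Tendsto (fun n => ∫ ω, m n ω ∂μ) atTop (𝓝 0) := by
    have h3 : Tendsto (fun n => ‖y (ns n) - z‖) atTop (𝓝 0) :=
      tendsto_iff_norm_sub_tendsto_zero.1 (hy.comp hns.tendsto_atTop)
    have h4 := (h3.rpow_const (p := r) (Or.inr hr0.le)).const_mul C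
    rw [Real.zero_rpow hr0.ne', mul_zero] at h4
    refine h4.congr fun n => ?_
    simp only [hm]
    rw [integral_const_mul, ← norm_Lp_rpow hr0]
  refine squeeze_zero (fun n => integral_nonneg fun ω => by positivity) (fun n => ?_)
    (by simpa using h1.add h2)
  rw [← integral_add (hpi n) (hmi n)]
  refine integral_mono (hei n) ((hpi n).add (hmi n)) fun ω => ?_
  dsimp only
  linarith [le_max_left (e n ω - m n ω) 0]

end Continuity

section NormSq

variable {X : Type*} [NormedAddCommGroup X] [NormedSpace ℝ X]

theorem fderiv_fderiv_norm_rpow_two_eq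
    (hc : Continuous (fderiv ℝ (fderiv ℝ (fun x : X => ‖x‖ ^ (2 : ℝ))))) (x : X) :
    fderiv ℝ (fderiv ℝ (fun x : X => ‖x‖ ^ (2 : ℝ))) x =
      fderiv ℝ (fderiv ℝ (fun x : X => ‖x‖ ^ (2 : ℝ))) 0 := by
  set φ : X → ℝ := fun x => ‖x‖ ^ (2 : ℝ) with hφ
  have h1 : ∀ t : ℝ, t ≠ 0 → ∀ x, fderiv ℝ φ (t • x) = t • fderiv ℝ φ x := by
    intro t ht x
    have e : (fun x => φ (t • x)) = (t ^ 2) • φ := by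
      ext x
      simp [hφ, norm_smul, mul_pow]
    have h2 := fderiv_comp_smul (𝕜 := ℝ) (f := φ) (x := x) t
    rw [e, fderiv_const_smul_field] at h2
    have h3 := congrArg (fun L => t⁻¹ • L) h2
    simp only [Pi.smul_apply, smul_smul, inv_mul_cancel₀ ht, one_smul] at h3
    rw [← h3]; congr 1; field_simp
  have h2 : ∀ t : ℝ, t ≠ 0 → fderiv ℝ (fderiv ℝ φ) (t • x) = fderiv ℝ (fderiv ℝ φ) x := by
    intro t ht
    have e : (fun x => fderiv ℝ φ (t • x)) = t • fderiv ℝ φ := by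
      ext1 x
      exact h1 t ht x
    have h2 := fderiv_comp_smul (𝕜 := ℝ) (f := fderiv ℝ φ) (x := x) t
    have h3 : fderiv ℝ (t • fderiv ℝ φ) x = t • fderiv ℝ (fderiv ℝ φ) x :=
      congrFun (fderiv_const_smul_field (F := X →L[ℝ] ℝ) t) x
    rw [e, h3] at h2
    exact (smul_right_injective _ ht h2).symm
  have hlim : Tendsto (fun t : ℝ => fderiv ℝ (fderiv ℝ φ) (t • x)) (𝓝[≠] 0)
      (𝓝 (fderiv ℝ (fderiv ℝ φ) 0)) := by
    have h4 : Continuous fun t : ℝ => fderiv ℝ (fderiv ℝ φ) (t • x) :=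
      hc.comp (continuous_id.smul continuous_const)
    have h5 := h4.tendsto 0
    rw [zero_smul] at h5
    exact h5.mono_left nhdsWithin_le_nhds
  refine tendsto_nhds_unique (Tendsto.congr' ?_ tendsto_const_nhds) hlim
  filter_upwards [self_mem_nhdsWithin] with t ht
  exact (h2 t ht).symm

end NormSq

/-- If a real Banach space `X` satisfies condition `(C_r)` for some `r ∈ [2, ∞)` with constants
`k₁, k₂ > 0`, then for any probability space `(Ω, 𝒜, P)` the Bochner space `Y = L^r(Ω; X)`
satisfies condition `(C_r)` with the same constants `k₁, k₂`. -/
theorem conditionCr_Lp {X : Type*} [NormedAddCommGroup X] [NormedSpace ℝ X]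
    [CompleteSpace X]
    {Ω : Type*} [MeasurableSpace Ω] (P : Measure Ω) [IsProbabilityMeasure P]
    (r k₁ k₂ : ℝ) (hr : 2 ≤ r) (hk₁ : 0 < k₁) (hk₂ : 0 < k₂)
    [Fact (1 ≤ ENNReal.ofReal r)]
    (hX : ConditionCr X r k₁ k₂) :
    ConditionCr (Lp X (ENNReal.ofReal r) P) r k₁ k₂ := by
  obtain ⟨hφ, hb₁, hb₂⟩ := hX
  have hr0 : 0 < r := by linarith
  have hφ1 : ContDiff ℝ 1 (fderiv ℝ (fun x : X => ‖x‖ ^ r)) := hφ.fderiv_right (by norm_num)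
  have hd₁ : ∀ x : X, HasFDerivAt (fun x : X => ‖x‖ ^ r) (fderiv ℝ (fun x : X => ‖x‖ ^ r) x) x :=
    fun x => (hφ.differentiable (by norm_num) x).hasFDerivAt
  have hd₂ := fun x : X => (hφ1.differentiable (by norm_num) x).hasFDerivAt
  have hc₁ := hφ1.continuous
  have hc₂ := hφ1.continuous_fderiv (by norm_num)
  have hconst : r = 2 → ∀ x : X, fderiv ℝ (fderiv ℝ (fun x : X => ‖x‖ ^ r)) x =
      fderiv ℝ (fderiv ℝ (fun x : X => ‖x‖ ^ r)) 0 := by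
    rintro rfl
    exact fderiv_fderiv_norm_rpow_two_eq hc₂
  generalize fderiv ℝ (fderiv ℝ (fun x : X => ‖x‖ ^ r)) = φ'' at hb₂ hd₂ hc₂ hconst
  generalize fderiv ℝ (fun x : X => ‖x‖ ^ r) = φ' at hb₁ hd₁ hd₂ hc₁
  have hb₂' : ∀ (y : Lp X (ENNReal.ofReal r) P) ω,
      ‖φ'' (y ω)‖ ≤ k₂ * (‖y ω‖ ^ r) ^ ((r - 2) / r) := fun y ω => by
    rw [rpow_rpow_sub_two_div (norm_nonneg _) hr]
    exact hb₂ _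
  have hm₁ := fun y : Lp X (ENNReal.ofReal r) P =>
    hc₁.comp_aestronglyMeasurable (Lp.aestronglyMeasurable y)
  have hm₂ := fun y : Lp X (ENNReal.ofReal r) P =>
    hc₂.comp_aestronglyMeasurable (Lp.aestronglyMeasurable y)
  choose A hA using fun y : Lp X (ENNReal.ofReal r) P =>
    exists_clm_eq_integral_apply hr hk₁.le (hm₁ y) (fun ω => hb₁ (y ω))
  choose B hB using fun y : Lp X (ENNReal.ofReal r) P =>
    exists_clm_eq_integral_apply_apply hr hk₂.le (hm₂ y) (integrable_norm_rpow_Lp hr0 y)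
      (fun ω => by positivity) (hb₂' y)
  have hBi := fun y : Lp X (ENNReal.ofReal r) P =>
    integrable_clm_apply_apply hr (hm₂ y) (integrable_norm_rpow_Lp hr0 y)
      (fun ω => by positivity) (hb₂' y)
  have hBc : Continuous B := by
    rcases hr.eq_or_lt with h | h
    · have : B = fun _ => B 0 := by
        ext y h k
        rw [hB, hB]
        refine integral_congr_ae (ae_of_all _ fun ω => ?_)
        simp only [hconst ‹2 = r›.symm (y ω),
          hconst ‹2 = r›.symm ((0 : Lp X (ENNReal.ofReal r) P) ω)]
      rw [this]
      exact continuous_const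
    · rw [continuous_iff_continuousAt]
      intro z
      have hθ : 0 < (r - 2) / r := div_pos (by linarith) hr0
      have hlim := (tendsto_integral_norm_sub_rpow h hk₂.le hc₂ hb₂ z).rpow_const
        (p := (r - 2) / r) (Or.inr hθ.le)
      rw [Real.zero_rpow hθ.ne'] at hlim
      refine (tendsto_iff_norm_sub_tendsto_zero
        (E := Lp X (ENNReal.ofReal r) P →L[ℝ] Lp X (ENNReal.ofReal r) P →L[ℝ] ℝ)).2
        (squeeze_zero (fun _ => ContinuousLinearMap.opNorm_nonneg _) (fun y => ?_) hlim)
      refine ContinuousLinearMap.opNorm_le_bound₂ _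
        (Real.rpow_nonneg (integral_nonneg fun ω => by positivity) _) fun u v => ?_
      have H := norm_integral_clm_apply_apply_le (G := fun ω => φ'' (y ω) - φ'' (z ω)) hr
        zero_le_one (integrable_norm_sub_rpow h hk₂.le hc₂ hb₂ y z) (fun ω => by positivity)
        (fun ω => by
          rw [one_mul, ← Real.rpow_mul (norm_nonneg _), div_mul_div_cancel₀ (by linarith),
            div_self hr0.ne', Real.rpow_one]) u v
      simp only [sub_apply, one_mul] at H ⊢
      rw [hB, hB, ← integral_sub (hBi y u v) (hBi z u v)]
      exact H
  have hAd : ∀ y, HasFDerivAt A (B y) y := hasFDerivAt_of_hasLineDerivAt_apply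
    (fun y h k => by
      simp only [hA, hB]
      exact hasLineDerivAt_integral_clm_apply hr hk₂.le hd₂ hc₂ hb₁ hb₂ y h k) hBc
  have hAc : Continuous A := continuous_iff_continuousAt.2 fun y => (hAd y).continuousAt
  have hψ : ∀ y, HasFDerivAt (fun y : Lp X (ENNReal.ofReal r) P => ‖y‖ ^ r) (A y) y :=
    hasFDerivAt_of_hasLineDerivAt (fun y h => by
      simp only [norm_Lp_rpow hr0, hA]
      exact hasLineDerivAt_integral_norm_rpow hr hk₁.le hd₁ hc₁ hb₁ y h) hAc
  have e₁ : fderiv ℝ (fun y : Lp X (ENNReal.ofReal r) P => ‖y‖ ^ r) = A :=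
    funext fun y => (hψ y).fderiv
  have e₂ : fderiv ℝ A = B := funext fun y => (hAd y).fderiv
  refine ⟨?_, fun y => ?_, fun y => ?_⟩
  · rw [← one_add_one_eq_two, contDiff_succ_iff_fderiv, e₁, contDiff_one_iff_fderiv, e₂]
    exact ⟨fun y => (hψ y).differentiableAt, by simp, fun y => (hAd y).differentiableAt, hBc⟩
  · rw [e₁]
    refine ContinuousLinearMap.opNorm_le_bound _ (by positivity) fun h => ?_
    rw [hA]
    exact norm_integral_clm_apply_le hr hk₁.le (fun ω => hb₁ (y ω)) h
  · rw [e₁, e₂]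
    refine ContinuousLinearMap.opNorm_le_bound₂ _ (by positivity) fun h k => ?_
    rw [hB, ← integral_norm_rpow_rpow hr]
    exact norm_integral_clm_apply_apply_le hr hk₂.le (integrable_norm_rpow_Lp hr0 y)
      (fun ω => by positivity) (hb₂' y) h k
end

section
/- Let X be a real Banach space and r ∈ [2, ∞) such that X satisfies condition (C_r) with constants k₁, k₂ > 0, and write φ(x) = ‖x‖^r. Let (Ω, 𝒜, P) be a probability space and Y = L^r(Ω; X). Then the Fréchet derivative of ψ : Y → ℝ, ψ(y) = ‖y‖_{L^r(Ω;X)}^r, is given by ψ'(y)u = ∫_Ω φ'(y(ω))(u(ω)) dP(ω) for all y, u ∈ L^r(Ω; X). -/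
open MeasureTheory

/-- Weighted Young-type inequality, in a form that is homogeneous in the scale `t`. -/
lemma rpow_sub_mul_rpow_le {r s a b t : ℝ} (hs : 0 ≤ s) (hsr : s ≤ r)
    (ha : 0 ≤ a) (hb : 0 ≤ b) (ht : 0 < t) :
    a ^ (r - s) * b ^ s ≤ t ^ s * (a ^ r + (b ^ r) / t ^ r) := by
  have hbt : 0 ≤ b / t := by positivity
  have key : a ^ (r - s) * (b / t) ^ s ≤ a ^ r + (b / t) ^ r := by
    have hm : 0 ≤ max a (b / t) := le_max_of_le_left ha
    calc a ^ (r - s) * (b / t) ^ s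
        ≤ max a (b / t) ^ (r - s) * max a (b / t) ^ s := by
          gcongr
          · exact le_max_left _ _
          · exact le_max_right _ _
      _ = max a (b / t) ^ r := by
          rw [← Real.rpow_add_of_nonneg hm (by linarith) hs]; congr 1; ring
      _ ≤ a ^ r + (b / t) ^ r := by
          rcases max_cases a (b / t) with ⟨h, -⟩ | ⟨h, -⟩ <;> rw [h]
          · exact le_add_of_nonneg_right (by positivity)
          · exact le_add_of_nonneg_left (by positivity)
  rw [← Real.div_rpow hb ht.le]
  calc a ^ (r - s) * b ^ s = t ^ s * (a ^ (r - s) * (b / t) ^ s) := by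
        rw [Real.div_rpow hb ht.le]
        have : t ^ s ≠ 0 := by positivity
        field_simp
    _ ≤ _ := by gcongr

/-- Taylor bound of first order for `‖·‖ ^ r` under `ConditionCr`. -/
lemma ConditionCr.abs_taylor_le {X : Type*} [NormedAddCommGroup X] [NormedSpace ℝ X]
    {r k₁ k₂ : ℝ} (hX : ConditionCr X r k₁ k₂) (hr : 2 ≤ r) (hk₂ : 0 ≤ k₂) (x v : X) :
    |‖x + v‖ ^ r - ‖x‖ ^ r - fderiv ℝ (fun x : X => ‖x‖ ^ r) x v|
      ≤ k₂ * (‖x‖ + ‖v‖) ^ (r - 2) * ‖v‖ ^ 2 := by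
  obtain ⟨hC, -, h2⟩ := hX
  set φ : X → ℝ := fun x => ‖x‖ ^ r with hφ
  have hd : Differentiable ℝ φ := hC.differentiable (by norm_num)
  have hd' : Differentiable ℝ (fderiv ℝ φ) :=
    (hC.fderiv_right (m := 1) (by norm_num)).differentiable (by norm_num)
  have hxs : x ∈ Metric.closedBall x ‖v‖ := by simp
  have hsecond : ∀ z ∈ Metric.closedBall x ‖v‖,
      ‖fderiv ℝ (fderiv ℝ φ) z‖ ≤ k₂ * (‖x‖ + ‖v‖) ^ (r - 2) := fun z hz => by
    refine (h2 z).trans ?_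
    have hz' : ‖z‖ ≤ ‖x‖ + ‖v‖ := norm_le_of_mem_closedBall hz
    gcongr
  have hfirst : ∀ z ∈ Metric.closedBall x ‖v‖,
      ‖fderiv ℝ φ z - fderiv ℝ φ x‖ ≤ k₂ * (‖x‖ + ‖v‖) ^ (r - 2) * ‖v‖ := fun z hz => by
    refine ((convex_closedBall x ‖v‖).norm_image_sub_le_of_norm_fderiv_le
      (fun w _ => hd' w) hsecond hxs hz).trans ?_
    have := mem_closedBall_iff_norm.1 hz
    gcongr
  have := (convex_closedBall x ‖v‖).norm_image_sub_le_of_norm_fderiv_le'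
    (fun w _ => hd w) hfirst hxs (y := x + v) (by simp)
  rw [add_sub_cancel_left, Real.norm_eq_abs] at this
  exact this.trans_eq (by ring)

lemma ConditionCr.abs_taylor_le_add {X : Type*} [NormedAddCommGroup X] [NormedSpace ℝ X]
    {r k₁ k₂ : ℝ} (hX : ConditionCr X r k₁ k₂) (hr : 2 ≤ r) (hk₂ : 0 ≤ k₂) (x v : X) :
    |‖x + v‖ ^ r - ‖x‖ ^ r - fderiv ℝ (fun x : X => ‖x‖ ^ r) x v|
      ≤ k₂ * 2 ^ (r - 2) * (‖x‖ ^ (r - 2) * ‖v‖ ^ (2 : ℝ) + ‖v‖ ^ r) := by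
  refine (hX.abs_taylor_le hr hk₂ x v).trans ?_
  have hr' : 0 ≤ r - 2 := by linarith
  have hv : ‖v‖ ^ r = ‖v‖ ^ (r - 2) * ‖v‖ ^ (2 : ℝ) := by
    rw [← Real.rpow_add_of_nonneg (norm_nonneg v) hr' (by norm_num)]; congr 1; ring
  rw [hv, ← add_mul, ← mul_assoc, mul_assoc k₂ (2 ^ (r - 2)), Real.rpow_two]
  gcongr
  calc (‖x‖ + ‖v‖) ^ (r - 2) ≤ (2 * max ‖x‖ ‖v‖) ^ (r - 2) := by
        gcongr
        linarith [le_max_left ‖x‖ ‖v‖, le_max_right ‖x‖ ‖v‖]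
    _ = 2 ^ (r - 2) * max ‖x‖ ‖v‖ ^ (r - 2) :=
        Real.mul_rpow (by norm_num) (le_max_of_le_left (norm_nonneg x))
    _ ≤ _ := by
        gcongr
        rcases max_cases ‖x‖ ‖v‖ with ⟨h, -⟩ | ⟨h, -⟩ <;> rw [h]
        · exact le_add_of_nonneg_right (by positivity)
        · exact le_add_of_nonneg_left (by positivity)

section Lp

variable {X : Type*} [NormedAddCommGroup X] {Ω : Type*} [MeasurableSpace Ω] {P : Measure Ω}
  {r s : ℝ}

lemma MeasureTheory.Lp.integrable_norm_rpow_ofReal (hr : 0 < r)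
    (y : Lp X (ENNReal.ofReal r) P) : Integrable (fun ω => ‖y ω‖ ^ r) P := by
  have := (Lp.memLp y).integrable_norm_rpow (by simpa using hr) ENNReal.ofReal_ne_top
  rwa [ENNReal.toReal_ofReal hr.le] at this

lemma MeasureTheory.Lp.norm_rpow_eq_integral (hr : 0 < r)
    (y : Lp X (ENNReal.ofReal r) P) : ‖y‖ ^ r = ∫ ω, ‖y ω‖ ^ r ∂P := by
  have hnn : 0 ≤ ∫ ω, ‖y ω‖ ^ r ∂P := integral_nonneg fun ω => by positivity
  rw [Lp.norm_def, (Lp.memLp y).eLpNorm_eq_integral_rpow_norm (by simpa using hr)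
    ENNReal.ofReal_ne_top, ENNReal.toReal_ofReal hr.le, ENNReal.toReal_ofReal (by positivity),
    ← Real.rpow_mul hnn, inv_mul_cancel₀ hr.ne', Real.rpow_one]

lemma MeasureTheory.Lp.integrable_norm_rpow_sub_mul (hr : 0 < r) (hs : 0 ≤ s) (hsr : s ≤ r)
    (y h : Lp X (ENNReal.ofReal r) P) :
    Integrable (fun ω => ‖y ω‖ ^ (r - s) * ‖h ω‖ ^ s) P := by
  refine ((Lp.integrable_norm_rpow_ofReal hr y).add
    (Lp.integrable_norm_rpow_ofReal hr h)).mono' ?_ (.of_forall fun ω => ?_)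
  · exact (((Real.continuous_rpow_const (by linarith)).comp_aestronglyMeasurable
      (Lp.aestronglyMeasurable y).norm)).mul
      ((Real.continuous_rpow_const hs).comp_aestronglyMeasurable
      (Lp.aestronglyMeasurable h).norm)
  · rw [Real.norm_of_nonneg (by positivity)]
    simpa using rpow_sub_mul_rpow_le hs hsr (norm_nonneg (y ω)) (norm_nonneg (h ω)) one_pos

lemma MeasureTheory.Lp.integral_norm_rpow_sub_mul_le [Fact (1 ≤ ENNReal.ofReal r)]
    (hr : 0 < r) (hs : 0 < s) (hsr : s ≤ r) (y h : Lp X (ENNReal.ofReal r) P) :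
    ∫ ω, ‖y ω‖ ^ (r - s) * ‖h ω‖ ^ s ∂P ≤ (‖y‖ ^ r + 1) * ‖h‖ ^ s := by
  rcases eq_or_ne h 0 with rfl | hh
  · have : ∫ ω, ‖y ω‖ ^ (r - s) * ‖(0 : Lp X (ENNReal.ofReal r) P) ω‖ ^ s ∂P = 0 := by
      refine integral_eq_zero_of_ae ?_
      filter_upwards [Lp.coeFn_zero X (ENNReal.ofReal r) P] with ω hω
      have h0 : ‖(0 : Lp X (ENNReal.ofReal r) P) ω‖ = 0 := by rw [hω]; simp
      simp only [h0, Real.zero_rpow hs.ne', mul_zero, Pi.zero_apply]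
    rw [this]; positivity
  have ht : 0 < ‖h‖ := norm_pos_iff.2 hh
  have hi := Lp.integrable_norm_rpow_ofReal hr y
  have hi' := (Lp.integrable_norm_rpow_ofReal hr h).div_const (‖h‖ ^ r)
  calc ∫ ω, ‖y ω‖ ^ (r - s) * ‖h ω‖ ^ s ∂P
      ≤ ∫ ω, ‖h‖ ^ s * (‖y ω‖ ^ r + ‖h ω‖ ^ r / ‖h‖ ^ r) ∂P :=
        integral_mono (Lp.integrable_norm_rpow_sub_mul hr hs.le hsr y h)
          ((hi.add hi').const_mul _) fun ω =>
            rpow_sub_mul_rpow_le hs.le hsr (norm_nonneg _) (norm_nonneg _) ht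
    _ = (‖y‖ ^ r + 1) * ‖h‖ ^ s := by
        rw [integral_const_mul, integral_add hi hi', integral_div,
          ← Lp.norm_rpow_eq_integral hr, ← Lp.norm_rpow_eq_integral hr,
          div_self (by positivity), mul_comm]

variable [NormedSpace ℝ X] {k₁ k₂ : ℝ}

lemma ConditionCr.norm_fderiv_apply_le (hX : ConditionCr X r k₁ k₂) (x v : X) :
    ‖fderiv ℝ (fun x : X => ‖x‖ ^ r) x v‖ ≤ k₁ * (‖x‖ ^ (r - 1) * ‖v‖ ^ (1 : ℝ)) := by
  rw [Real.rpow_one, ← mul_assoc]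
  exact ContinuousLinearMap.le_of_opNorm_le _ (hX.2.1 x) v

lemma ConditionCr.integrable_fderiv_apply (hX : ConditionCr X r k₁ k₂) (hr : 1 ≤ r)
    (y u : Lp X (ENNReal.ofReal r) P) :
    Integrable (fun ω => fderiv ℝ (fun x : X => ‖x‖ ^ r) (y ω) (u ω)) P := by
  refine ((Lp.integrable_norm_rpow_sub_mul (by linarith) zero_le_one hr y u).const_mul k₁).mono'
    ?_ (.of_forall fun ω => hX.norm_fderiv_apply_le _ _)
  have hc : Continuous fun p : X × X => fderiv ℝ (fun x : X => ‖x‖ ^ r) p.1 p.2 :=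
    hX.1.continuous_fderiv_apply (by norm_num)
  exact hc.comp_aestronglyMeasurable
    ((Lp.aestronglyMeasurable y).prodMk (Lp.aestronglyMeasurable u))

/-- The functional `u ↦ ∫ φ'(y(ω))(u(ω)) dP(ω)` on `L^r`, where `φ = ‖·‖ ^ r`. -/
noncomputable def ConditionCr.integralFDeriv [Fact (1 ≤ ENNReal.ofReal r)]
    (hX : ConditionCr X r k₁ k₂) (hr : 1 ≤ r) (hk₁ : 0 ≤ k₁) (y : Lp X (ENNReal.ofReal r) P) :
    Lp X (ENNReal.ofReal r) P →L[ℝ] ℝ :=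
  LinearMap.mkContinuous
    { toFun := fun u => ∫ ω, fderiv ℝ (fun x : X => ‖x‖ ^ r) (y ω) (u ω) ∂P
      map_add' := fun u v => by
        rw [← integral_add (hX.integrable_fderiv_apply hr y u)
          (hX.integrable_fderiv_apply hr y v)]
        refine integral_congr_ae ?_
        filter_upwards [Lp.coeFn_add u v] with ω hω
        simp only [hω, Pi.add_apply, map_add]
      map_smul' := fun c u => by
        rw [RingHom.id_apply, smul_eq_mul, ← integral_const_mul]
        refine integral_congr_ae ?_
        filter_upwards [Lp.coeFn_smul c u] with ω hω
        simp only [hω, Pi.smul_apply, map_smul, smul_eq_mul] }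
    (k₁ * (‖y‖ ^ r + 1)) fun u => by
      have hi := Lp.integrable_norm_rpow_sub_mul (by linarith) zero_le_one hr y u
      refine (norm_integral_le_of_norm_le (hi.const_mul k₁)
        (.of_forall fun ω => hX.norm_fderiv_apply_le _ _)).trans ?_
      rw [integral_const_mul, mul_assoc]
      have := Lp.integral_norm_rpow_sub_mul_le (by linarith) one_pos hr y u
      rw [Real.rpow_one ‖u‖] at this
      gcongr

lemma ConditionCr.abs_taylor_Lp_le [Fact (1 ≤ ENNReal.ofReal r)]
    (hX : ConditionCr X r k₁ k₂) (hr : 2 ≤ r) (hk₂ : 0 ≤ k₂)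
    (y h : Lp X (ENNReal.ofReal r) P) :
    |‖y + h‖ ^ r - ‖y‖ ^ r - ∫ ω, fderiv ℝ (fun x : X => ‖x‖ ^ r) (y ω) (h ω) ∂P|
      ≤ k₂ * 2 ^ (r - 2) * ((‖y‖ ^ r + 1) * ‖h‖ ^ (2 : ℝ) + ‖h‖ ^ r) := by
  have hr0 : 0 < r := by linarith
  have hi := Lp.integrable_norm_rpow_sub_mul hr0 zero_le_two hr y h
  have hih := Lp.integrable_norm_rpow_ofReal hr0 h
  have hsub : Integrable (fun ω => ‖(y + h) ω‖ ^ r - ‖y ω‖ ^ r) P :=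
    (Lp.integrable_norm_rpow_ofReal hr0 (y + h)).sub
    (Lp.integrable_norm_rpow_ofReal hr0 y)
  rw [Lp.norm_rpow_eq_integral hr0 (y + h), Lp.norm_rpow_eq_integral hr0 y,
    ← integral_sub (Lp.integrable_norm_rpow_ofReal hr0 (y + h))
      (Lp.integrable_norm_rpow_ofReal hr0 y),
    ← integral_sub hsub (hX.integrable_fderiv_apply (by linarith) y h), ← Real.norm_eq_abs]
  refine (norm_integral_le_of_norm_le ((hi.add hih).const_mul (k₂ * 2 ^ (r - 2))) ?_).trans ?_
  · filter_upwards [Lp.coeFn_add y h] with ω hω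
    simpa only [hω, Pi.add_apply, Real.norm_eq_abs] using hX.abs_taylor_le_add hr hk₂ (y ω) (h ω)
  · rw [integral_const_mul]
    simp only [Pi.add_apply]
    rw [integral_add hi hih, ← Lp.norm_rpow_eq_integral hr0, ← Lp.norm_rpow_eq_integral hr0]
    gcongr
    exact Lp.integral_norm_rpow_sub_mul_le hr0 two_pos hr y h

theorem ConditionCr.hasFDerivAt_norm_rpow_Lp [Fact (1 ≤ ENNReal.ofReal r)]
    (hX : ConditionCr X r k₁ k₂) (hr : 2 ≤ r) (hk₁ : 0 ≤ k₁) (hk₂ : 0 ≤ k₂)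
    (y : Lp X (ENNReal.ofReal r) P) :
    HasFDerivAt (fun z : Lp X (ENNReal.ofReal r) P => ‖z‖ ^ r)
      (hX.integralFDeriv (one_le_two.trans hr) hk₁ y) y := by
  rw [hasFDerivAt_iff_isLittleO_nhds_zero]
  refine Asymptotics.IsBigO.trans_isLittleO ?_
    (Asymptotics.isLittleO_norm_pow_id (n := 2) one_lt_two)
  refine .of_bound (k₂ * 2 ^ (r - 2) * (‖y‖ ^ r + 1 + 1)) ?_
  filter_upwards [Metric.ball_mem_nhds _ one_pos] with h hh
  refine (hX.abs_taylor_Lp_le hr hk₂ y h).trans ?_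
  have hle : ‖h‖ ^ r ≤ ‖h‖ ^ (2 : ℝ) :=
    Real.rpow_le_rpow_of_exponent_ge_of_imp (norm_nonneg h) (mem_ball_zero_iff.1 hh).le hr
      (fun _ h0 => by linarith)
  rw [norm_pow, norm_norm, mul_assoc _ (_ + 1), ← Real.rpow_two]
  gcongr
  linarith

end Lp

/-- If `X` satisfies condition `(C_r)` with `φ x = ‖x‖^r`, then the Fréchet derivative of
`ψ : L^r(Ω;X) → ℝ`, `ψ y = ‖y‖^r`, is given by `ψ'(y)u = ∫_Ω φ'(y(ω))(u(ω)) dP(ω)`. -/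
theorem fderiv_norm_rpow_Lp {X : Type*} [NormedAddCommGroup X] [NormedSpace ℝ X]
    [CompleteSpace X]
    {Ω : Type*} [MeasurableSpace Ω] (P : Measure Ω) [IsProbabilityMeasure P]
    (r k₁ k₂ : ℝ) (hr : 2 ≤ r) (hk₁ : 0 < k₁) (hk₂ : 0 < k₂)
    [Fact (1 ≤ ENNReal.ofReal r)]
    (hX : ConditionCr X r k₁ k₂)
    (y u : Lp X (ENNReal.ofReal r) P) :
    fderiv ℝ (fun z : Lp X (ENNReal.ofReal r) P => ‖z‖ ^ r) y u
      = ∫ ω, fderiv ℝ (fun x : X => ‖x‖ ^ r) (y ω) (u ω) ∂P := by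
  exact congrArg (fun L : Lp X (ENNReal.ofReal r) P →L[ℝ] ℝ => L u)
    (hX.hasFDerivAt_norm_rpow_Lp hr hk₁.le hk₂.le y).fderiv
end

section
/- Let X be a real Banach space and r ∈ [2, ∞). If X satisfies condition (C_r) for some constants k₁, k₂ > 0, then for every s ∈ [r, ∞) the space X satisfies condition (C_s); that is, there exist constants k₁', k₂' > 0 (depending on r, s, k₁, k₂) such that the function x ↦ ‖x‖^s is twice continuously Fréchet differentiable on X with ‖(‖·‖^s)'(x)‖ ≤ k₁' ‖x‖^{s−1} and ‖(‖·‖^s)''(x)‖ ≤ k₂' ‖x‖^{s−2} for all x ∈ X. -/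
open MeasureTheory

section NormRpow

variable {X : Type*} [NormedAddCommGroup X] [NormedSpace ℝ X] {r s k₁ k₂ : ℝ}

theorem hasFDerivAt_norm_rpow_of_le (hr : 0 < r) (hrs : r ≤ s)
    (hφ : Differentiable ℝ (fun x : X => ‖x‖ ^ r)) (x : X) :
    HasFDerivAt (fun x : X => ‖x‖ ^ s)
      ((s / r * ‖x‖ ^ (s - r)) • fderiv ℝ (fun x : X => ‖x‖ ^ r) x) x := by
  have h := (hφ x).hasFDerivAt.rpow_const (p := s / r) (Or.inr ((one_le_div hr).2 hrs))
  have hpow : ∀ (y : X) (t : ℝ), (‖y‖ ^ r) ^ t = ‖y‖ ^ (r * t) :=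
    fun y t => (Real.rpow_mul (norm_nonneg y) r t).symm
  have e₁ : r * (s / r) = s := by field_simp
  have e₂ : r * (s / r - 1) = s - r := by field_simp
  simpa only [hpow, e₁, e₂] using h

theorem norm_fderiv_norm_rpow_le_of_le (hr : 1 < r) (hrs : r ≤ s)
    (hφ : Differentiable ℝ (fun x : X => ‖x‖ ^ r))
    (hb : ∀ x : X, ‖fderiv ℝ (fun x : X => ‖x‖ ^ r) x‖ ≤ k₁ * ‖x‖ ^ (r - 1)) (x : X) :
    ‖fderiv ℝ (fun x : X => ‖x‖ ^ s) x‖ ≤ s / r * k₁ * ‖x‖ ^ (s - 1) := by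
  have hr0 : 0 < r := one_pos.trans hr
  have hs : 0 < s := hr0.trans_le hrs
  have hc : 0 ≤ s / r * ‖x‖ ^ (s - r) := by positivity
  rw [(hasFDerivAt_norm_rpow_of_le hr0 hrs hφ x).fderiv, norm_smul, Real.norm_of_nonneg hc]
  calc s / r * ‖x‖ ^ (s - r) * ‖fderiv ℝ (fun x : X => ‖x‖ ^ r) x‖
      ≤ s / r * ‖x‖ ^ (s - r) * (k₁ * ‖x‖ ^ (r - 1)) := by gcongr; exact hb x
    _ = s / r * k₁ * (‖x‖ ^ (s - r) * ‖x‖ ^ (r - 1)) := by ring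
    _ = s / r * k₁ * ‖x‖ ^ (s - 1) := by
      rw [← Real.rpow_add_of_nonneg (norm_nonneg x) (by linarith) (by linarith)]
      ring_nf

theorem contDiffAt_norm_rpow_of_ne_zero (hr : r ≠ 0) {n : WithTop ℕ∞}
    (hφ : ContDiff ℝ n (fun x : X => ‖x‖ ^ r)) {x : X} (hx : x ≠ 0) :
    ContDiffAt ℝ n (fun x : X => ‖x‖ ^ s) x := by
  have h := hφ.contDiffAt (x := x).rpow_const_of_ne (p := s / r)
    (Real.rpow_pos_of_pos (norm_pos_iff.2 hx) r).ne'
  have e : r * (s / r) = s := by field_simp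
  simpa only [← Real.rpow_mul (norm_nonneg _), e] using h

theorem norm_fderiv_fderiv_norm_rpow_le_of_ne_zero (hr : 0 < r) (hrs : r ≤ s)
    (hφ : ContDiff ℝ 2 (fun x : X => ‖x‖ ^ r))
    (hb₁ : ∀ x : X, ‖fderiv ℝ (fun x : X => ‖x‖ ^ r) x‖ ≤ k₁ * ‖x‖ ^ (r - 1))
    (hb₂ : ∀ x : X, ‖fderiv ℝ (fderiv ℝ (fun x : X => ‖x‖ ^ r)) x‖ ≤ k₂ * ‖x‖ ^ (r - 2))
    {x : X} (hx : x ≠ 0) :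
    ‖fderiv ℝ (fderiv ℝ (fun x : X => ‖x‖ ^ s)) x‖
      ≤ (s / r * k₂ + s / r * (s / r - 1) * k₁ ^ 2) * ‖x‖ ^ (s - 2) := by
  have hd : Differentiable ℝ (fun x : X => ‖x‖ ^ r) := hφ.differentiable (by norm_num)
  have hx' : 0 < ‖x‖ := norm_pos_iff.2 hx
  have hp : 1 ≤ s / r := (one_le_div hr).2 hrs
  have hφ' : DifferentiableAt ℝ (fderiv ℝ (fun x : X => ‖x‖ ^ r)) x :=
    (hφ.fderiv_right (m := 1) (by norm_num)).differentiable (by norm_num) x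
  have hpow : HasFDerivAt (fun x : X => s / r * ‖x‖ ^ (s - r))
      ((s / r) • (((s / r - 1) * ‖x‖ ^ (s - 2 * r)) •
        fderiv ℝ (fun x : X => ‖x‖ ^ r) x)) x := by
    have h := ((hd x).hasFDerivAt.rpow_const (p := s / r - 1)
      (Or.inl (Real.rpow_pos_of_pos hx' r).ne')).const_mul (s / r)
    have hpow : ∀ (y : X) (t : ℝ), (‖y‖ ^ r) ^ t = ‖y‖ ^ (r * t) :=
      fun y t => (Real.rpow_mul (norm_nonneg y) r t).symm
    have e₁ : r * (s / r - 1) = s - r := by field_simp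
    have e₂ : r * (s / r - 1 - 1) = s - 2 * r := by field_simp; ring
    simpa only [hpow, e₁, e₂] using h
  have hfun : fderiv ℝ (fun x : X => ‖x‖ ^ s) =
      fun x => (s / r * ‖x‖ ^ (s - r)) • fderiv ℝ (fun x : X => ‖x‖ ^ r) x :=
    funext fun y => (hasFDerivAt_norm_rpow_of_le hr hrs hd y).fderiv
  rw [hfun, (hpow.fun_smul hφ'.hasFDerivAt).fderiv]
  refine (ContinuousLinearMap.opNorm_add_le _ _).trans ?_
  rw [ContinuousLinearMap.norm_smulRight_apply, norm_smul, norm_smul, norm_smul,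
    Real.norm_of_nonneg (by positivity : 0 ≤ s / r * ‖x‖ ^ (s - r)),
    Real.norm_of_nonneg (by positivity : 0 ≤ s / r),
    Real.norm_of_nonneg (mul_nonneg (sub_nonneg.2 hp) (by positivity) :
      0 ≤ (s / r - 1) * ‖x‖ ^ (s - 2 * r))]
  set D := ‖fderiv ℝ (fun x : X => ‖x‖ ^ r) x‖ with hD
  have hp' : 0 ≤ s / r - 1 := sub_nonneg.2 hp
  have e₁ : ‖x‖ ^ (s - r) * ‖x‖ ^ (r - 2) = ‖x‖ ^ (s - 2) := by
    rw [← Real.rpow_add hx']; ring_nf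
  have e₂ : ‖x‖ ^ (s - 2 * r) * (‖x‖ ^ (r - 1) * ‖x‖ ^ (r - 1)) = ‖x‖ ^ (s - 2) := by
    rw [← Real.rpow_add hx', ← Real.rpow_add hx']; ring_nf
  have hDD : D * D ≤ (k₁ * ‖x‖ ^ (r - 1)) * (k₁ * ‖x‖ ^ (r - 1)) :=
    mul_self_le_mul_self (norm_nonneg _) (hb₁ x)
  calc _ ≤ s / r * ‖x‖ ^ (s - r) * (k₂ * ‖x‖ ^ (r - 2)) +
        s / r * ((s / r - 1) * ‖x‖ ^ (s - 2 * r)) *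
          ((k₁ * ‖x‖ ^ (r - 1)) * (k₁ * ‖x‖ ^ (r - 1))) := by
        refine add_le_add (by gcongr; exact hb₂ x) ?_
        calc _ = s / r * ((s / r - 1) * ‖x‖ ^ (s - 2 * r)) * (D * D) := by ring
          _ ≤ _ := by gcongr
    _ = s / r * k₂ * (‖x‖ ^ (s - r) * ‖x‖ ^ (r - 2)) + s / r * (s / r - 1) * k₁ ^ 2 *
        (‖x‖ ^ (s - 2 * r) * (‖x‖ ^ (r - 1) * ‖x‖ ^ (r - 1))) := by ring
    _ = _ := by rw [e₁, e₂]; ring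

end NormRpow

/-- A map bounded by `C * ‖x‖ ^ t` with `1 < t` has derivative zero at the origin. -/
theorem hasFDerivAt_zero_of_norm_le_rpow {E F : Type*} [NormedAddCommGroup E] [NormedSpace ℝ E]
    [NormedAddCommGroup F] [NormedSpace ℝ F] {f : E → F} {C t : ℝ} (ht : 1 < t)
    (hf : ∀ x, ‖f x‖ ≤ C * ‖x‖ ^ t) : HasFDerivAt f (0 : E →L[ℝ] F) 0 := by
  have h0 : f 0 = 0 := by
    simpa [Real.zero_rpow (by linarith : t ≠ 0)] using hf 0
  have hO : f =O[nhds 0] fun x : E => ‖x‖ ^ t :=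
    Asymptotics.IsBigO.of_bound C (Filter.Eventually.of_forall fun x => by
      rw [Real.norm_of_nonneg (by positivity)]
      exact hf x)
  rw [hasFDerivAt_iff_isLittleO_nhds_zero]
  have hlim : (fun x : E => ‖x‖ ^ (t - 1)) =o[nhds 0] fun _ : E => (1 : ℝ) := by
    rw [Asymptotics.isLittleO_one_iff]
    have h : Continuous fun x : E => ‖x‖ ^ (t - 1) :=
      continuous_norm.rpow_const fun _ => Or.inr (by linarith)
    simpa [Real.zero_rpow (by linarith : t - 1 ≠ 0)] using h.tendsto 0
  have ho : (fun x : E => ‖x‖ ^ t) =o[nhds 0] fun x : E => ‖x‖ := by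
    refine (hlim.mul_isBigO (Asymptotics.isBigO_refl (fun x : E => ‖x‖) _)).congr
      (fun x => ?_) fun x => one_mul _
    rw [← Real.rpow_add_one' (norm_nonneg x) (by linarith), sub_add_cancel]
  simpa [h0] using (hO.trans_isLittleO ho).of_norm_right

/-- If `X` satisfies condition `(C_r)` for some `r ∈ [2, ∞)`, then `X` satisfies condition
`(C_s)` for every `s ∈ [r, ∞)`, with constants depending only on `r, s, k₁, k₂`. -/
theorem conditionCr_mono {X : Type*} [NormedAddCommGroup X] [NormedSpace ℝ X]
    [CompleteSpace X]
    (r k₁ k₂ : ℝ) (hr : 2 ≤ r) (hk₁ : 0 < k₁) (hk₂ : 0 < k₂)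
    (hX : ConditionCr X r k₁ k₂) :
    ∀ s : ℝ, r ≤ s → ∃ k₁' k₂' : ℝ, 0 < k₁' ∧ 0 < k₂' ∧ ConditionCr X s k₁' k₂' := by
  obtain ⟨hφ, hb₁, hb₂⟩ := hX
  intro s hrs
  obtain rfl | hlt := hrs.eq_or_lt
  · exact ⟨k₁, k₂, hk₁, hk₂, hφ, hb₁, hb₂⟩
  have hr0 : 0 < r := by linarith
  have hs0 : 0 < s := by linarith
  have hd : Differentiable ℝ (fun x : X => ‖x‖ ^ r) := hφ.differentiable (by norm_num)
  have hp : 0 ≤ s / r - 1 := sub_nonneg.2 ((one_le_div hr0).2 hrs)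
  have hbound₁ := norm_fderiv_norm_rpow_le_of_le (by linarith) hrs hd hb₁
  have hzero := hasFDerivAt_zero_of_norm_le_rpow (by linarith) hbound₁
  have hbound₂ : ∀ x : X, ‖fderiv ℝ (fderiv ℝ (fun x : X => ‖x‖ ^ s)) x‖
      ≤ (s / r * k₂ + s / r * (s / r - 1) * k₁ ^ 2) * ‖x‖ ^ (s - 2) := by
    intro x
    obtain rfl | hx := eq_or_ne x 0
    · rw [hzero.fderiv, ContinuousLinearMap.opNorm_zero]
      positivity
    · exact norm_fderiv_fderiv_norm_rpow_le_of_ne_zero hr0 hrs hφ hb₁ hb₂ hx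
  have hC1 : ∀ x : X, x ≠ 0 → ContDiffAt ℝ 1 (fderiv ℝ (fun x : X => ‖x‖ ^ s)) x :=
    fun x hx => (contDiffAt_norm_rpow_of_ne_zero hr0.ne' hφ hx).fderiv_right (by norm_num)
  refine ⟨s / r * k₁, s / r * k₂ + s / r * (s / r - 1) * k₁ ^ 2, by positivity, by positivity,
    ?_, hbound₁, hbound₂⟩
  rw [show (2 : WithTop ℕ∞) = 1 + 1 by norm_num, contDiff_succ_iff_fderiv]
  refine ⟨fun x => (hasFDerivAt_norm_rpow_of_le hr0 hrs hd x).differentiableAt, by simp, ?_⟩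
  rw [contDiff_one_iff_fderiv]
  refine ⟨fun x => ?_, continuous_iff_continuousAt.2 fun x => ?_⟩
  · obtain rfl | hx := eq_or_ne x 0
    · exact hzero.differentiableAt
    · exact (hC1 x hx).differentiableAt (by norm_num)
  · obtain rfl | hx := eq_or_ne x 0
    · rw [ContinuousAt, hzero.fderiv]
      refine squeeze_zero_norm hbound₂ ?_
      have h : Continuous fun x : X =>
          (s / r * k₂ + s / r * (s / r - 1) * k₁ ^ 2) * ‖x‖ ^ (s - 2) :=
        continuous_const.mul (continuous_norm.rpow_const fun _ => Or.inr (by linarith))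
      simpa [Real.zero_rpow (by linarith : s - 2 ≠ 0)] using h.tendsto 0
    · exact ((hC1 x hx).fderiv_right (m := 0) (by norm_num)).continuousAt
end

section
/- Let (𝒪, Σ, μ) be a σ-finite measure space, let p ∈ [2, ∞) and r ∈ [p, ∞). Then the real Banach space X = L^p(𝒪, μ) (real-valued L^p functions) satisfies condition (C_r): the function φ : X → ℝ, φ(f) = ‖f‖_{L^p}^r, is twice continuously Fréchet differentiable, and there exist constants k₁, k₂ > 0 (depending only on p and r) such that ‖φ'(f)‖ ≤ k₁ ‖f‖_{L^p}^{r−1} and ‖φ''(f)‖ ≤ k₂ ‖f‖_{L^p}^{r−2} for all f ∈ L^p(𝒪, μ). -/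
open MeasureTheory

section

set_option maxSynthPendingDepth 3

open Filter Topology

namespace ConditionCr

variable {X : Type*} [NormedAddCommGroup X] [NormedSpace ℝ X]

theorem of_hasFDerivAt {r k₁ k₂ : ℝ} {φ' : X → X →L[ℝ] ℝ} {φ'' : X → X →L[ℝ] X →L[ℝ] ℝ}
    (h₁ : ∀ x, HasFDerivAt (fun x : X => ‖x‖ ^ r) (φ' x) x)
    (h₂ : ∀ x, HasFDerivAt φ' (φ'' x) x) (hc : Continuous φ'')
    (hb₁ : ∀ x, ‖φ' x‖ ≤ k₁ * ‖x‖ ^ (r - 1)) (hb₂ : ∀ x, ‖φ'' x‖ ≤ k₂ * ‖x‖ ^ (r - 2)) :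
    ConditionCr X r k₁ k₂ := by
  have e₁ : fderiv ℝ (fun x : X => ‖x‖ ^ r) = φ' := funext fun x => (h₁ x).fderiv
  have e₂ : fderiv ℝ φ' = φ'' := funext fun x => (h₂ x).fderiv
  refine ⟨?_, by simpa only [e₁] using hb₁, by simpa only [e₁, e₂] using hb₂⟩
  have h : ContDiff ℝ ((1 : ℕ) + 1) (fun x : X => ‖x‖ ^ r) :=
    contDiff_succ_iff_hasFDerivAt.2
      ⟨φ', by exact_mod_cast contDiff_one_iff_hasFDerivAt.2 ⟨φ'', hc, h₂⟩, h₁⟩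
  exact_mod_cast h

/-- Condition `(C_p)` implies condition `(C_r)` for larger exponents `r`. -/
theorem mono_exponent {p r k₁ k₂ : ℝ} (hp : 2 ≤ p) (hpr : p ≤ r) (hk₁ : 0 ≤ k₁)
    (h : ConditionCr X p k₁ k₂) :
    ConditionCr X r (r / p * k₁) (r / p * (k₂ + (r - p) / p * (k₁ * k₁))) := by
  obtain rfl | hlt := hpr.eq_or_lt
  · simpa [div_self (show p ≠ 0 by linarith)] using h
  obtain ⟨hC, hb₁, hb₂⟩ := h
  set N : X → ℝ := fun x => ‖x‖ ^ p with hN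
  have hp0 : 0 < p := by linarith
  have hq : 1 < r / p := (one_lt_div hp0).2 hlt
  have hNpow (x : X) (a : ℝ) : N x ^ a = ‖x‖ ^ (p * a) := (Real.rpow_mul (norm_nonneg x) p a).symm
  have hC' : ContDiff ℝ ((1 : ℕ) + 1) N := by exact_mod_cast hC
  have hC1 : ContDiff ℝ 1 (fderiv ℝ N) := by
    have := (contDiff_succ_iff_fderiv.1 hC').2.2
    exact_mod_cast this
  have hd (x : X) : HasFDerivAt N (fderiv ℝ N x) x :=
    (hC.differentiable (by norm_num) x).hasFDerivAt
  have hd' (x : X) : HasFDerivAt (fderiv ℝ N) (fderiv ℝ (fderiv ℝ N) x) x :=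
    (hC1.differentiable (by norm_num) x).hasFDerivAt
  have hc : Continuous (fderiv ℝ (fderiv ℝ N)) := hC1.continuous_fderiv (by norm_num)
  have hrp : 0 < r - p := by linarith
  set φ' : X → X →L[ℝ] ℝ := fun x => (r / p * ‖x‖ ^ (r - p)) • fderiv ℝ N x with hφ'
  set φ'' : X → X →L[ℝ] X →L[ℝ] ℝ := fun x =>
    (r / p) • (‖x‖ ^ (r - p) • fderiv ℝ (fderiv ℝ N) x +
      ((r - p) / p * ‖x‖ ^ (r - 2 * p)) • (fderiv ℝ N x).smulRight (fderiv ℝ N x)) with hφ''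
  have hzero : fderiv ℝ N 0 = 0 := by
    have := hb₁ 0
    rw [norm_zero, Real.zero_rpow (by linarith), mul_zero] at this
    exact norm_le_zero_iff.1 this
  have hbφ' (x : X) : ‖φ' x‖ ≤ r / p * k₁ * ‖x‖ ^ (r - 1) := by
    have e : ‖x‖ ^ (r - p) * ‖x‖ ^ (p - 1) = ‖x‖ ^ (r - 1) := by
      rw [← Real.rpow_add' (norm_nonneg x) (by linarith)]
      congr 1; ring
    rw [hφ', norm_smul, Real.norm_of_nonneg (by positivity)]
    calc _ ≤ (r / p * ‖x‖ ^ (r - p)) * (k₁ * ‖x‖ ^ (p - 1)) := by gcongr; exact hb₁ x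
      _ = _ := by rw [← e]; ring
  have hbφ'' (x : X) :
      ‖φ'' x‖ ≤ r / p * (k₂ + (r - p) / p * (k₁ * k₁)) * ‖x‖ ^ (r - 2) := by
    obtain rfl | hx := eq_or_ne x 0
    · simp [hφ'', hzero, Real.zero_rpow hrp.ne', Real.zero_rpow (show r - 2 ≠ 0 by linarith)]
    have hx' : 0 < ‖x‖ := norm_pos_iff.2 hx
    have e₁ : ‖x‖ ^ (r - p) * ‖x‖ ^ (p - 2) = ‖x‖ ^ (r - 2) := by
      rw [← Real.rpow_add hx']; congr 1; ring
    have e₂ : ‖x‖ ^ (r - 2 * p) * (‖x‖ ^ (p - 1) * ‖x‖ ^ (p - 1)) = ‖x‖ ^ (r - 2) := by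
      rw [← Real.rpow_add hx', ← Real.rpow_add hx']; congr 1; ring
    rw [hφ'', norm_smul, Real.norm_of_nonneg (by positivity)]
    calc _ ≤ r / p * (‖x‖ ^ (r - p) * (k₂ * ‖x‖ ^ (p - 2)) + ((r - p) / p * ‖x‖ ^ (r - 2 * p)) *
            ((k₁ * ‖x‖ ^ (p - 1)) * (k₁ * ‖x‖ ^ (p - 1)))) := by
          gcongr
          refine (norm_add_le _ _).trans (add_le_add ?_ ?_)
          · rw [norm_smul, Real.norm_of_nonneg (by positivity)]
            gcongr
            exact hb₂ x
          · rw [norm_smul, Real.norm_of_nonneg (by positivity),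
              ContinuousLinearMap.norm_smulRight_apply]
            gcongr <;> exact hb₁ x
      _ = r / p * (k₂ * (‖x‖ ^ (r - p) * ‖x‖ ^ (p - 2)) + (r - p) / p * (k₁ * k₁) *
            (‖x‖ ^ (r - 2 * p) * (‖x‖ ^ (p - 1) * ‖x‖ ^ (p - 1)))) := by ring
      _ = _ := by rw [e₁, e₂]; ring
  refine of_hasFDerivAt (φ' := φ') (φ'' := φ'') (fun x => ?_) (fun x => ?_) ?_ hbφ' hbφ''
  · have := (hd x).rpow_const (p := r / p) (Or.inr hq.le)
    simp only [hNpow] at this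
    convert this using 4
    · field_simp
    · field_simp
  · obtain rfl | hx := eq_or_ne x 0
    · have h0 : φ'' 0 = 0 := by simp [hφ'', hzero, Real.zero_rpow hrp.ne']
      have h0' : φ' 0 = 0 := by simp [hφ', hzero]
      rw [h0, hasFDerivAt_iff_isLittleO_nhds_zero]
      simp only [zero_add, h0', sub_zero, zero_apply]
      have h1 : φ' =O[𝓝 0] fun x => ‖x‖ ^ (r - 2) * ‖x‖ := by
        refine Asymptotics.IsBigO.of_bound (r / p * k₁) (Eventually.of_forall fun x => ?_)
        have e : ‖x‖ ^ (r - 2) * ‖x‖ = ‖x‖ ^ (r - 1) := by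
          rw [← Real.rpow_add_one' (norm_nonneg x) (by linarith)]
          congr 1; ring
        rw [Real.norm_of_nonneg (by positivity), e]
        exact hbφ' x
      refine h1.trans_isLittleO ?_
      have h2 : (fun x : X => ‖x‖ ^ (r - 2)) =o[𝓝 0] fun _ => (1 : ℝ) := by
        rw [Asymptotics.isLittleO_one_iff]
        have : Continuous fun x : X => ‖x‖ ^ (r - 2) :=
          continuous_norm.rpow_const fun _ => Or.inr (by linarith)
        simpa [Real.zero_rpow (show r - 2 ≠ 0 by linarith)] using this.tendsto 0
      have h3 := h2.mul_isBigO (Asymptotics.isBigO_refl (fun x : X => ‖x‖) (𝓝 0))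
      simp only [one_mul] at h3
      exact h3.of_norm_right
    · have hNx : N x ≠ 0 := (Real.rpow_pos_of_pos (norm_pos_iff.2 hx) p).ne'
      have h1 := (hd x).rpow_const (p := (r - p) / p) (Or.inl hNx)
      simp only [hNpow] at h1
      have h2 := (h1.fun_smul (hd' x)).fun_const_smul (r / p)
      have e₁ : p * ((r - p) / p) = r - p := by field_simp
      have e₂ : p * ((r - p) / p - 1) = r - 2 * p := by field_simp; ring
      rw [e₁, e₂] at h2
      simp only [smul_smul] at h2
      refine h2.congr_fderiv (ContinuousLinearMap.ext fun u => ContinuousLinearMap.ext fun v => ?_)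
      simp [hφ'', mul_assoc]
  · refine continuous_iff_continuousAt.2 fun x => ?_
    obtain rfl | hx := eq_or_ne x 0
    · have h0 : φ'' 0 = 0 := by simp [hφ'', hzero, Real.zero_rpow hrp.ne']
      rw [ContinuousAt, h0]
      refine squeeze_zero_norm hbφ'' ?_
      have : Continuous fun x : X => r / p * (k₂ + (r - p) / p * (k₁ * k₁)) * ‖x‖ ^ (r - 2) :=
        continuous_const.mul (continuous_norm.rpow_const fun _ => Or.inr (by linarith))
      simpa [Real.zero_rpow (show r - 2 ≠ 0 by linarith)] using this.tendsto 0
    · have hn : ‖x‖ ≠ 0 := norm_ne_zero_iff.2 hx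
      have a₁ : ContinuousAt (fun x : X => ‖x‖ ^ (r - p)) x :=
        continuous_norm.continuousAt.rpow_const (Or.inl hn)
      have a₂ : ContinuousAt (fun x : X => ‖x‖ ^ (r - 2 * p)) x :=
        continuous_norm.continuousAt.rpow_const (Or.inl hn)
      have a₃ : Continuous fun x : X => (fderiv ℝ N x).smulRight (fderiv ℝ N x) :=
        ((ContinuousLinearMap.smulRightL ℝ X (X →L[ℝ] ℝ)).continuous.comp
          hC1.continuous).clm_apply hC1.continuous
      exact ((a₁.smul hc.continuousAt).add
        (ContinuousAt.smul (a₂.const_mul _) a₃.continuousAt)).const_smul (r / p)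

end ConditionCr

theorem Real.hasDerivAt_abs_rpow_mul_self {s : ℝ} (hs : 0 ≤ s) (t : ℝ) :
    HasDerivAt (fun t : ℝ => |t| ^ s * t) ((s + 1) * |t| ^ s) t := by
  have hc : Continuous fun t : ℝ => |t| ^ s := continuous_abs.rpow_const fun _ => Or.inr hs
  have hne (t : ℝ) (ht : t ≠ 0) :
      HasDerivAt (fun t : ℝ => |t| ^ s * t) ((s + 1) * |t| ^ s) t := by
    have ha : |t| ≠ 0 := abs_ne_zero.2 ht
    refine (((hasDerivAt_abs ht).rpow_const (p := s) (Or.inl ha)).mul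
      (hasDerivAt_id' t)).congr_deriv (Eq.symm ?_)
    have e : |t| ^ s = |t| ^ (s - 1) * |t| := by
      rw [← Real.rpow_add_one ha]; congr 1; ring
    have e' : (SignType.sign t : ℝ) * t = |t| := sign_mul_self t
    calc (s + 1) * |t| ^ s = s * (|t| ^ (s - 1) * |t|) + |t| ^ s := by rw [← e]; ring
      _ = _ := by rw [← e']; ring
  obtain rfl | ht := eq_or_ne t 0
  · exact hasDerivAt_of_hasDerivAt_of_ne hne (hc.mul continuous_id).continuousAt
      (hc.const_mul _).continuousAt
  · exact hne t ht

/-- A modulus of continuity for `t ↦ |t| ^ s`, homogeneous of degree `s`. -/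
theorem Real.exists_abs_abs_rpow_sub_le {s : ℝ} (hs : 0 ≤ s) {ε : ℝ} (hε : 0 < ε) :
    ∃ C : ℝ, 0 ≤ C ∧ Tendsto (fun t : ℝ => C * t ^ s) (𝓝 0) (𝓝 0) ∧
      ∀ a b : ℝ, |(|b| ^ s - |a| ^ s)| ≤ ε * |a| ^ s + C * |b - a| ^ s := by
  obtain rfl | hs' := hs.eq_or_lt
  · refine ⟨0, le_rfl, by simp, fun a b => ?_⟩
    simpa using hε.le
  have hcont : ContinuousAt (fun t : ℝ => t ^ s) 1 :=
    Real.continuousAt_rpow_const 1 s (Or.inl one_ne_zero)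
  obtain ⟨δ, hδ, h⟩ := Metric.continuousAt_iff.1 hcont ε hε
  simp only [Real.dist_eq, Real.one_rpow] at h
  have h0 : Tendsto (fun t : ℝ => (1 + δ⁻¹) ^ s * t ^ s) (𝓝 0) (𝓝 0) := by
    have := ((Real.continuous_rpow_const hs).const_mul ((1 + δ⁻¹) ^ s)).tendsto 0
    simpa [Real.zero_rpow hs'.ne'] using this
  refine ⟨(1 + δ⁻¹) ^ s, by positivity, h0, fun a b => ?_⟩
  by_cases hab : |b - a| < δ * |a|
  · have ha : 0 < |a| := by
      by_contra hcon
      have : |a| = 0 := le_antisymm (not_lt.1 hcon) (abs_nonneg a)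
      rw [this, mul_zero] at hab
      exact absurd hab (not_lt.2 (abs_nonneg _))
    have h1 : |(|b| / |a| - 1)| < δ := by
      rw [div_sub_one ha.ne', abs_div, abs_abs, div_lt_iff₀ ha]
      exact (abs_abs_sub_abs_le b a).trans_lt hab
    have h2 := h h1
    have e : |b| ^ s - |a| ^ s = ((|b| / |a|) ^ s - 1) * |a| ^ s := by
      rw [Real.div_rpow (abs_nonneg b) (abs_nonneg a)]
      field_simp
    rw [e, abs_mul, abs_of_nonneg (show 0 ≤ |a| ^ s by positivity)]
    refine (mul_le_mul_of_nonneg_right h2.le (by positivity)).trans ?_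
    have : 0 ≤ (1 + δ⁻¹) ^ s * |b - a| ^ s := by positivity
    linarith
  · have ha : |a| ≤ δ⁻¹ * |b - a| := by
      rw [inv_mul_eq_div, le_div_iff₀ hδ]
      linarith [not_lt.1 hab]
    have hb : |b| ≤ |a| + |b - a| := by
      have := abs_add_le a (b - a)
      rwa [add_sub_cancel] at this
    have hle : ∀ c, 0 ≤ c → c ≤ (1 + δ⁻¹) * |b - a| → c ^ s ≤ (1 + δ⁻¹) ^ s * |b - a| ^ s := by
      intro c hc hc'
      rw [← Real.mul_rpow (by positivity) (abs_nonneg _)]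
      exact Real.rpow_le_rpow hc hc' hs
    have h1 := hle |a| (abs_nonneg a) (by linarith [abs_nonneg (b - a)])
    have h2 := hle |b| (abs_nonneg b) (by linarith)
    have h3 : 0 ≤ |a| ^ s := by positivity
    have h4 : 0 ≤ |b| ^ s := by positivity
    have h5 : 0 ≤ ε * |a| ^ s := by positivity
    rw [abs_le]
    constructor <;> linarith

theorem Real.abs_rpow_mul_self_taylor_le {s : ℝ} (hs : 0 ≤ s) {ε C : ℝ} (hC : 0 ≤ C)
    (h : ∀ a b : ℝ, |(|b| ^ s - |a| ^ s)| ≤ ε * |a| ^ s + C * |b - a| ^ s) (a b : ℝ) :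
    |(|a + b| ^ s * (a + b) - |a| ^ s * a - (s + 1) * (|a| ^ s * b))| ≤
      (s + 1) * ((ε * |a| ^ s + C * |b| ^ s) * |b|) := by
  have hd (t : ℝ) : HasDerivAt (fun t => |t| ^ s * t - (s + 1) * |a| ^ s * t)
      ((s + 1) * |t| ^ s - (s + 1) * |a| ^ s) t := by
    exact ((Real.hasDerivAt_abs_rpow_mul_self hs t).sub
      ((hasDerivAt_id' t).const_mul ((s + 1) * |a| ^ s))).congr_deriv (by rw [mul_one])
  have hb (t : ℝ) (ht : t ∈ Metric.closedBall a |b|) :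
      ‖(s + 1) * |t| ^ s - (s + 1) * |a| ^ s‖ ≤ (s + 1) * (ε * |a| ^ s + C * |b| ^ s) := by
    have hta : |t - a| ≤ |b| := by simpa [Real.dist_eq] using ht
    rw [← mul_sub, norm_mul, Real.norm_of_nonneg (by linarith : 0 ≤ s + 1), Real.norm_eq_abs]
    gcongr
    refine (h a t).trans ?_
    gcongr
  have key := (convex_closedBall a |b|).norm_image_sub_le_of_norm_hasDerivWithin_le
    (fun t _ => (hd t).hasDerivWithinAt) hb (Metric.mem_closedBall_self (abs_nonneg b))
    (show a + b ∈ Metric.closedBall a |b| by simp)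
  rw [Real.norm_eq_abs, add_sub_cancel_left, Real.norm_eq_abs] at key
  rw [← mul_assoc (s + 1) (_ + _)]
  refine le_of_eq_of_le (congrArg _ ?_) key
  ring

theorem Real.exists_abs_rpow_modulus_le {E : Type*} [SeminormedAddCommGroup E] {s : ℝ} (hs : 0 ≤ s)
    {M c : ℝ} (hM : 0 ≤ M) (hc : 0 < c) :
    ∃ ε C : ℝ, 0 ≤ ε ∧ 0 ≤ C ∧
      (∀ a b : ℝ, |(|b| ^ s - |a| ^ s)| ≤ ε * |a| ^ s + C * |b - a| ^ s) ∧
      ∀ᶠ h : E in 𝓝 0, ε * M + C * ‖h‖ ^ s ≤ c := by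
  have hε : 0 < c / 2 / (M + 1) := by positivity
  obtain ⟨C, hC, hlim, hle⟩ := Real.exists_abs_abs_rpow_sub_le hs hε
  refine ⟨_, C, hε.le, hC, hle, ?_⟩
  have h1 : Tendsto (fun h : E => C * ‖h‖ ^ s) (𝓝 0) (𝓝 0) := hlim.comp tendsto_norm_zero
  filter_upwards [h1.eventually (gt_mem_nhds (half_pos hc))] with h hh
  have h2 : c / 2 / (M + 1) * M ≤ c / 2 := by
    rw [div_mul_eq_mul_div, div_le_iff₀ (by positivity)]
    exact mul_le_mul_of_nonneg_left (by linarith) (by positivity)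
  linarith

namespace MeasureTheory

variable {α : Type*} [MeasurableSpace α] {μ : Measure α} {p : ℝ}

/-- Hölder's inequality with exponents `p / (p - 2)`, `p`, `p`. -/
theorem lintegral_enorm_rpow_mul_mul_le (hp : 2 ≤ p) {f g h : α → ℝ}
    (hf : AEStronglyMeasurable f μ) (hg : AEStronglyMeasurable g μ)
    (hh : AEStronglyMeasurable h μ) :
    ∫⁻ x, ‖f x‖ₑ ^ (p - 2) * ‖g x‖ₑ * ‖h x‖ₑ ∂μ ≤
      eLpNorm f (ENNReal.ofReal p) μ ^ (p - 2) * eLpNorm g (ENNReal.ofReal p) μ *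
        eLpNorm h (ENNReal.ofReal p) μ := by
  have hp0 : 0 < p := by linarith
  have hnorm (u : α → ℝ) :
      eLpNorm u (ENNReal.ofReal p) μ = (∫⁻ x, ‖u x‖ₑ ^ p ∂μ) ^ (1 / p) := by
    rw [eLpNorm_eq_lintegral_rpow_enorm_toReal (by simpa using hp0) ENNReal.ofReal_ne_top,
      ENNReal.toReal_ofReal hp0.le]
  have key := ENNReal.lintegral_prod_norm_pow_le (μ := μ) Finset.univ
    (f := ![fun x => ‖f x‖ₑ ^ p, fun x => ‖g x‖ₑ ^ p, fun x => ‖h x‖ₑ ^ p])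
    (p := ![(p - 2) / p, 1 / p, 1 / p]) (fun i _ => by
      fin_cases i
      exacts [hf.enorm.pow_const p, hg.enorm.pow_const p, hh.enorm.pow_const p])
    (by simp [Fin.sum_univ_three]; field_simp; ring)
    (fun i _ => by
      fin_cases i
      exacts [div_nonneg (by linarith) hp0.le, by simpa using hp0.le, by simpa using hp0.le])
  simp only [Fin.prod_univ_three, Matrix.cons_val_zero, Matrix.cons_val_one, Matrix.cons_val,
    ← ENNReal.rpow_mul] at key
  have e₁ : p * ((p - 2) / p) = p - 2 := by field_simp
  have e₂ : p * (1 / p) = 1 := by field_simp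
  have e₃ : (p - 2) / p = 1 / p * (p - 2) := by ring
  simp only [e₁, e₂, ENNReal.rpow_one] at key
  rwa [e₃, ENNReal.rpow_mul, ← hnorm, ← hnorm, ← hnorm] at key

namespace Lp

theorem aestronglyMeasurable_abs_rpow (f : Lp ℝ (ENNReal.ofReal p) μ) (s : ℝ) :
    AEStronglyMeasurable (fun x => |f x| ^ s) μ :=
  ((Lp.aestronglyMeasurable f).norm.aemeasurable.pow_const s).aestronglyMeasurable

theorem enorm_abs_rpow_mul_mul (hp : 2 ≤ p) (a b c : ℝ) :
    ‖|a| ^ (p - 2) * b * c‖ₑ = ‖a‖ₑ ^ (p - 2) * ‖b‖ₑ * ‖c‖ₑ := by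
  rw [enorm_mul, enorm_mul, Real.enorm_rpow_of_nonneg (abs_nonneg a) (by linarith), Real.enorm_abs]

theorem norm_abs_rpow_mul_mul (s a b c : ℝ) : ‖|a| ^ s * b * c‖ = |a| ^ s * |b| * |c| := by
  rw [norm_mul, norm_mul, Real.norm_of_nonneg (by positivity), Real.norm_eq_abs, Real.norm_eq_abs]

variable [Fact (1 ≤ ENNReal.ofReal p)]

theorem lintegral_enorm_rpow_mul_mul_le_ofReal (hp : 2 ≤ p) (f g h : Lp ℝ (ENNReal.ofReal p) μ) :
    ∫⁻ x, ‖f x‖ₑ ^ (p - 2) * ‖g x‖ₑ * ‖h x‖ₑ ∂μ ≤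
      ENNReal.ofReal (‖f‖ ^ (p - 2) * ‖g‖ * ‖h‖) := by
  refine (lintegral_enorm_rpow_mul_mul_le hp (Lp.aestronglyMeasurable f)
    (Lp.aestronglyMeasurable g) (Lp.aestronglyMeasurable h)).trans_eq ?_
  rw [ENNReal.ofReal_mul (by positivity), ENNReal.ofReal_mul (by positivity),
    ← ENNReal.ofReal_rpow_of_nonneg (norm_nonneg _) (by linarith)]
  simp only [Lp.norm_def, ENNReal.ofReal_toReal (Lp.eLpNorm_ne_top _)]

theorem integrable_abs_rpow_mul_mul (hp : 2 ≤ p) (f g h : Lp ℝ (ENNReal.ofReal p) μ) :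
    Integrable (fun x => |f x| ^ (p - 2) * g x * h x) μ := by
  refine ⟨((aestronglyMeasurable_abs_rpow f _).mul (Lp.aestronglyMeasurable g)).mul
    (Lp.aestronglyMeasurable h), ?_⟩
  simp only [hasFiniteIntegral_iff_enorm, enorm_abs_rpow_mul_mul hp]
  exact (lintegral_enorm_rpow_mul_mul_le_ofReal hp f g h).trans_lt ENNReal.ofReal_lt_top

theorem integral_abs_rpow_mul_mul_le (hp : 2 ≤ p) (f g h : Lp ℝ (ENNReal.ofReal p) μ) :
    ∫ x, |f x| ^ (p - 2) * |g x| * |h x| ∂μ ≤ ‖f‖ ^ (p - 2) * ‖g‖ * ‖h‖ := by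
  have hi := integrable_abs_rpow_mul_mul hp f g h
  simp only [← norm_abs_rpow_mul_mul]
  rw [integral_norm_eq_lintegral_enorm hi.aestronglyMeasurable]
  refine ENNReal.toReal_le_of_le_ofReal (by positivity) ?_
  simp only [enorm_abs_rpow_mul_mul hp]
  exact lintegral_enorm_rpow_mul_mul_le_ofReal hp f g h

theorem abs_integral_le_of_abs_le (hp : 2 ≤ p) {F : α → ℝ} {c₁ c₂ : ℝ} (hc₁ : 0 ≤ c₁) (hc₂ : 0 ≤ c₂)
    (f₁ f₂ g h : Lp ℝ (ENNReal.ofReal p) μ)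
    (hF : ∀ᵐ x ∂μ, |F x| ≤ (c₁ * |f₁ x| ^ (p - 2) + c₂ * |f₂ x| ^ (p - 2)) * |g x| * |h x|) :
    |∫ x, F x ∂μ| ≤ (c₁ * ‖f₁‖ ^ (p - 2) + c₂ * ‖f₂‖ ^ (p - 2)) * ‖g‖ * ‖h‖ := by
  have hi (f : Lp ℝ (ENNReal.ofReal p) μ) :
      Integrable (fun x => |f x| ^ (p - 2) * |g x| * |h x|) μ := by
    simpa only [norm_abs_rpow_mul_mul] using (integrable_abs_rpow_mul_mul hp f g h).norm
  have e (x : α) : (c₁ * |f₁ x| ^ (p - 2) + c₂ * |f₂ x| ^ (p - 2)) * |g x| * |h x| =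
      c₁ * (|f₁ x| ^ (p - 2) * |g x| * |h x|) + c₂ * (|f₂ x| ^ (p - 2) * |g x| * |h x|) := by ring
  simp only [e] at hF
  have hadd : Integrable (fun x => c₁ * (|f₁ x| ^ (p - 2) * |g x| * |h x|) +
      c₂ * (|f₂ x| ^ (p - 2) * |g x| * |h x|)) μ :=
    ((hi f₁).const_mul c₁).add ((hi f₂).const_mul c₂)
  calc |∫ x, F x ∂μ| ≤ ∫ x, (c₁ * (|f₁ x| ^ (p - 2) * |g x| * |h x|) +
        c₂ * (|f₂ x| ^ (p - 2) * |g x| * |h x|)) ∂μ := by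
          rw [← Real.norm_eq_abs]
          exact norm_integral_le_of_norm_le hadd (by simpa only [Real.norm_eq_abs] using hF)
    _ = c₁ * (∫ x, |f₁ x| ^ (p - 2) * |g x| * |h x| ∂μ) +
        c₂ * ∫ x, |f₂ x| ^ (p - 2) * |g x| * |h x| ∂μ := by
        rw [integral_add ((hi f₁).const_mul c₁) ((hi f₂).const_mul c₂), integral_const_mul,
          integral_const_mul]
    _ ≤ c₁ * (‖f₁‖ ^ (p - 2) * ‖g‖ * ‖h‖) + c₂ * (‖f₂‖ ^ (p - 2) * ‖g‖ * ‖h‖) := by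
        gcongr <;> exact integral_abs_rpow_mul_mul_le hp _ g h
    _ = _ := by ring

/-- The bilinear form `(g, h) ↦ ∫ |f| ^ (p - 2) g h` on `L^p`. -/
noncomputable def powForm (hp : 2 ≤ p) (f : Lp ℝ (ENNReal.ofReal p) μ) :
    Lp ℝ (ENNReal.ofReal p) μ →L[ℝ] Lp ℝ (ENNReal.ofReal p) μ →L[ℝ] ℝ :=
  LinearMap.mkContinuous₂
    (LinearMap.mk₂ ℝ (fun g h : Lp ℝ (ENNReal.ofReal p) μ => ∫ x, |f x| ^ (p - 2) * g x * h x ∂μ)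
      (fun g₁ g₂ h => by
        rw [← integral_add (integrable_abs_rpow_mul_mul hp f g₁ h)
          (integrable_abs_rpow_mul_mul hp f g₂ h)]
        refine integral_congr_ae ?_
        filter_upwards [Lp.coeFn_add g₁ g₂] with x hx
        rw [hx, Pi.add_apply]; ring)
      (fun c g h => by
        rw [smul_eq_mul, ← integral_const_mul]
        refine integral_congr_ae ?_
        filter_upwards [Lp.coeFn_smul c g] with x hx
        rw [hx, Pi.smul_apply, smul_eq_mul]; ring)
      (fun g h₁ h₂ => by
        rw [← integral_add (integrable_abs_rpow_mul_mul hp f g h₁)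
          (integrable_abs_rpow_mul_mul hp f g h₂)]
        refine integral_congr_ae ?_
        filter_upwards [Lp.coeFn_add h₁ h₂] with x hx
        rw [hx, Pi.add_apply]; ring)
      (fun c g h => by
        rw [smul_eq_mul, ← integral_const_mul]
        refine integral_congr_ae ?_
        filter_upwards [Lp.coeFn_smul c h] with x hx
        rw [hx, Pi.smul_apply, smul_eq_mul]; ring))
    (‖f‖ ^ (p - 2))
    (fun g h => by
      have := abs_integral_le_of_abs_le hp zero_le_one le_rfl f f g h
        (F := fun x => |f x| ^ (p - 2) * g x * h x) (.of_forall fun x => by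
          rw [one_mul, zero_mul, add_zero]; exact (norm_abs_rpow_mul_mul _ _ _ _).le)
      simpa using this)

theorem powForm_apply (hp : 2 ≤ p) (f g h : Lp ℝ (ENNReal.ofReal p) μ) :
    powForm hp f g h = ∫ x, |f x| ^ (p - 2) * g x * h x ∂μ := rfl

theorem powForm_comm (hp : 2 ≤ p) (f g h : Lp ℝ (ENNReal.ofReal p) μ) :
    powForm hp f g h = powForm hp f h g := by
  simp only [powForm_apply, mul_right_comm]

theorem norm_powForm_le (hp : 2 ≤ p) (f : Lp ℝ (ENNReal.ofReal p) μ) :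
    ‖powForm hp f‖ ≤ ‖f‖ ^ (p - 2) :=
  LinearMap.mkContinuous₂_norm_le _ (by positivity) _

theorem norm_rpow_eq_powForm (hp : 2 ≤ p) (f : Lp ℝ (ENNReal.ofReal p) μ) :
    ‖f‖ ^ p = powForm hp f f f := by
  have hp0 : 0 < p := by linarith
  have hint : 0 ≤ ∫ x, ‖f x‖ ^ p ∂μ := integral_nonneg fun x => by positivity
  rw [Lp.norm_def, (Lp.memLp f).eLpNorm_eq_integral_rpow_norm (by simpa using hp0)
    ENNReal.ofReal_ne_top, ENNReal.toReal_ofReal hp0.le, ENNReal.toReal_ofReal (by positivity),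
    ← Real.rpow_mul hint, inv_mul_cancel₀ hp0.ne', Real.rpow_one, powForm_apply]
  refine integral_congr_ae (.of_forall fun x => ?_)
  simp only [Real.norm_eq_abs]
  rw [mul_assoc, ← abs_mul_abs_self (f x), ← pow_two, ← Real.rpow_natCast |f x| 2,
    ← Real.rpow_add' (abs_nonneg _) (by norm_num; linarith)]
  norm_num

theorem continuous_powForm (hp : 2 ≤ p) :
    Continuous (powForm hp : Lp ℝ (ENNReal.ofReal p) μ → _) := by
  refine continuous_iff_continuousAt.2 fun f => ?_
  rw [ContinuousAt, ← tendsto_sub_nhds_zero_iff, ← map_add_left_nhds_zero, tendsto_map'_iff,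
    NormedAddGroup.tendsto_nhds_zero]
  intro c hc
  obtain ⟨ε, C, hε, hC, hle, hev⟩ := Real.exists_abs_rpow_modulus_le
    (E := Lp ℝ (ENNReal.ofReal p) μ) (by linarith : 0 ≤ p - 2)
    (by positivity : 0 ≤ ‖f‖ ^ (p - 2)) (half_pos hc)
  filter_upwards [hev] with u hu
  refine lt_of_le_of_lt ?_ (half_lt_self hc)
  refine le_trans ?_ hu
  refine ContinuousLinearMap.opNorm_le_bound₂ _ (by positivity) fun g h => ?_
  simp only [Function.comp_apply, sub_apply, powForm_apply]
  rw [← integral_sub (integrable_abs_rpow_mul_mul hp _ g h) (integrable_abs_rpow_mul_mul hp f g h)]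
  refine abs_integral_le_of_abs_le hp hε hC f u g h ?_
  filter_upwards [Lp.coeFn_add f u] with x hx
  have := hle (f x) (f x + u x)
  rw [add_sub_cancel_left] at this
  rw [hx, Pi.add_apply, ← sub_mul, ← sub_mul, abs_mul, abs_mul]
  gcongr

theorem hasFDerivAt_powForm_self (hp : 2 ≤ p) (f : Lp ℝ (ENNReal.ofReal p) μ) :
    HasFDerivAt (fun f : Lp ℝ (ENNReal.ofReal p) μ => powForm hp f f)
      ((p - 1) • powForm hp f) f := by
  rw [hasFDerivAt_iff_isLittleO_nhds_zero, Asymptotics.isLittleO_iff]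
  intro c hc
  have hp1 : 0 < p - 1 := by linarith
  obtain ⟨ε, C, hε, hC, hle, hev⟩ := Real.exists_abs_rpow_modulus_le
    (E := Lp ℝ (ENNReal.ofReal p) μ) (by linarith : 0 ≤ p - 2)
    (by positivity : 0 ≤ ‖f‖ ^ (p - 2)) (div_pos hc hp1)
  filter_upwards [hev] with u hu
  have hu' : (p - 1) * ε * ‖f‖ ^ (p - 2) + (p - 1) * C * ‖u‖ ^ (p - 2) ≤ c := by
    rw [le_div_iff₀ hp1] at hu
    linarith
  refine le_trans ?_ (mul_le_mul_of_nonneg_right hu' (norm_nonneg u))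
  refine ContinuousLinearMap.opNorm_le_bound _ (by positivity) fun h => ?_
  simp only [sub_apply, smul_apply, powForm_apply, smul_eq_mul]
  have hsub : Integrable (fun x => |(f + u) x| ^ (p - 2) * (f + u) x * h x -
      |f x| ^ (p - 2) * f x * h x) μ :=
    (integrable_abs_rpow_mul_mul hp _ _ h).sub (integrable_abs_rpow_mul_mul hp f f h)
  rw [← integral_const_mul, ← integral_sub (integrable_abs_rpow_mul_mul hp _ _ h)
    (integrable_abs_rpow_mul_mul hp f f h), ← integral_sub hsub
    ((integrable_abs_rpow_mul_mul hp f u h).const_mul _)]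
  refine abs_integral_le_of_abs_le hp (by positivity) (by positivity) f u u h ?_
  filter_upwards [Lp.coeFn_add f u] with x hx
  have key := Real.abs_rpow_mul_self_taylor_le (by linarith : 0 ≤ p - 2) hC hle (f x) (u x)
  rw [show p - 2 + 1 = p - 1 by ring] at key
  rw [hx, Pi.add_apply, ← mul_assoc, ← sub_mul, ← sub_mul, abs_mul]
  gcongr
  exact key.trans_eq (by ring)

theorem hasFDerivAt_norm_rpow (hp : 2 ≤ p) (f : Lp ℝ (ENNReal.ofReal p) μ) :
    HasFDerivAt (fun f : Lp ℝ (ENNReal.ofReal p) μ => ‖f‖ ^ p) (p • powForm hp f f) f := by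
  simp only [norm_rpow_eq_powForm hp]
  refine ((hasFDerivAt_powForm_self hp f).clm_apply (hasFDerivAt_id f)).congr_fderiv
    (ContinuousLinearMap.ext fun h => ?_)
  simp [powForm_comm hp f h f]
  ring

theorem conditionCr (hp : 2 ≤ p) :
    ConditionCr (Lp ℝ (ENNReal.ofReal p) μ) p p (p * (p - 1)) := by
  have hp1 : 0 ≤ p - 1 := by linarith
  refine ConditionCr.of_hasFDerivAt (hasFDerivAt_norm_rpow hp)
    (fun f => (hasFDerivAt_powForm_self hp f).const_smul p)
    (((continuous_powForm hp).const_smul (p - 1)).const_smul p) (fun f => ?_) (fun f => ?_)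
  · rw [norm_smul, Real.norm_of_nonneg (by linarith)]
    gcongr
    refine ((powForm hp f).le_opNorm f).trans ?_
    have e : ‖f‖ ^ (p - 1) = ‖f‖ ^ (p - 2) * ‖f‖ := by
      rw [← Real.rpow_add_one' (norm_nonneg f) (by linarith)]
      congr 1; ring
    rw [e]
    gcongr
    exact norm_powForm_le hp f
  · rw [norm_smul, norm_smul, Real.norm_of_nonneg (by linarith), Real.norm_of_nonneg hp1,
      ← mul_assoc]
    gcongr
    exact norm_powForm_le hp f

end Lp

end MeasureTheory

end

/-- For `p ∈ [2, ∞)` and `r ∈ [p, ∞)`, the real Banach space `L^p(𝒪, μ)` over any σ-finite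
measure space `(𝒪, Σ, μ)` satisfies condition `(C_r)`, with constants `k₁, k₂ > 0` depending
only on `p` and `r`. -/
theorem conditionCr_Lp_real (p r : ℝ) (hp : 2 ≤ p) (hpr : p ≤ r)
    [Fact (1 ≤ ENNReal.ofReal p)] :
    ∃ k₁ k₂ : ℝ, 0 < k₁ ∧ 0 < k₂ ∧
      ∀ (𝒪 : Type) [MeasurableSpace 𝒪] (μ : Measure 𝒪) [SigmaFinite μ],
        ConditionCr (Lp ℝ (ENNReal.ofReal p) μ) r k₁ k₂ := by
  have hp0 : 0 < p := by linarith
  have hr0 : 0 < r := by linarith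
  have hp1 : 0 < p - 1 := by linarith
  have hrp : 0 ≤ r - p := by linarith
  exact ⟨_, _, by positivity, by positivity, fun 𝒪 _ μ _ =>
    (Lp.conditionCr hp).mono_exponent hp hpr hp0.le⟩
end
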